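/- arXiv:2503.18196 — 3 statements merged into one kernel-verified Lean document; each statement's English description precedes it below -/
import Mathlib

section
/- Let X be a locally connected continuum homeomorphic (as a topological space) to its hyperspace NC*(X). Then X is homeomorphic to the unit interval [0,1]. -/
open TopologicalSpace Set

/-- The hyperspace NC*(X), as a subspace of the hyperspace of nonempty closed (= compact)
subsets of X with the Hausdorff metric. -/
abbrev NCstar (X : Type*) [MetricSpace X] :=
  {A : NonemptyCompacts X // IsConnected (A : Set X) ∧ IsPreconnected ((A : Set X)ᶜ)}

section Continua

variable {X : Type*} [TopologicalSpace X]

/-- Boundary bumping: a proper subcontinuum `T` of a continuum `S` can be enlarged inside `S`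
without leaving a given neighbourhood of `T`. -/
theorem exists_larger_subcontinuum [CompactSpace X] [T2Space X] {S T V : Set X}
    (hS : IsClosed S) (hSc : IsConnected S) (hTc : IsConnected T)
    (hTcl : IsClosed T) (hTS : T ⊂ S) (hV : IsOpen V) (hTV : T ⊆ V) :
    ∃ T', IsClosed T' ∧ IsConnected T' ∧ T ⊂ T' ∧ T' ⊆ S ∧ T' ⊆ V := by
  obtain ⟨V', hV'o, hTV', hV'V⟩ := normal_exists_closure_subset hTcl hV hTV
  by_cases hSV : S ⊆ V
  · exact ⟨S, hS, hSc, hTS, Subset.rfl, hSV⟩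
  obtain ⟨t, ht⟩ := hTc.nonempty
  set K := S ∩ closure V' with hK
  have hKcl : IsClosed K := hS.inter isClosed_closure
  have hTK : T ⊆ K := subset_inter hTS.subset (hTV'.trans subset_closure)
  have : CompactSpace K := isCompact_iff_compactSpace.1 hKcl.isCompact
  let t' : K := ⟨t, hTK ht⟩
  have hsub : T ⊆ connectedComponentIn K t :=
    hTc.isPreconnected.subset_connectedComponentIn ht hTK
  have hcl : IsClosed (connectedComponentIn K t) := by
    rw [connectedComponentIn_eq_image (hTK ht)]
    exact hKcl.isClosedEmbedding_subtypeVal.isClosedMap _ isClosed_connectedComponent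
  refine ⟨connectedComponentIn K t, hcl,
    isConnected_connectedComponentIn_iff.2 (hTK ht), ⟨hsub, fun hsub' => hSV ?_⟩,
    (connectedComponentIn_subset K t).trans inter_subset_left,
    (connectedComponentIn_subset K t).trans (inter_subset_right.trans hV'V)⟩
  -- the component lies in `V'`, hence so does a relatively clopen set containing it
  have hcomp : ⋂ s : { s : Set K // IsClopen s ∧ t' ∈ s }, (s : Set K) ⊆ (↑) ⁻¹' V' := by
    rw [← connectedComponent_eq_iInter_isClopen]
    intro x hx
    refine hTV' (hsub' ?_)
    rw [connectedComponentIn_eq_image (hTK ht)]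
    exact ⟨x, hx, rfl⟩
  have : Nonempty { s : Set K // IsClopen s ∧ t' ∈ s } := ⟨⟨univ, isClopen_univ, mem_univ _⟩⟩
  obtain ⟨⟨D, hD, htD⟩, hDV⟩ := exists_subset_nhds_of_compactSpace
    (V := fun s : { s : Set K // IsClopen s ∧ t' ∈ s } => (s : Set K))
    (fun a b => ⟨⟨a.1 ∩ b.1, a.2.1.inter b.2.1, a.2.2, b.2.2⟩,
      inter_subset_left, inter_subset_right⟩)
    (fun s => s.2.1.isClosed) (U := (↑) ⁻¹' V')
    (fun x hx => (hV'o.preimage continuous_subtype_val).mem_nhds (hcomp hx))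
  have hemb := hKcl.isClosedEmbedding_subtypeVal
  by_contra hnot
  obtain ⟨s, hsS, hsV⟩ := not_subset.1 hnot
  have h1 : IsClosed ((↑) '' D : Set X) := hemb.isClosedMap _ hD.isClosed
  have h2 : IsClosed ((↑) '' Dᶜ ∪ S \ V' : Set X) :=
    (hemb.isClosedMap _ hD.compl.isClosed).union (hS.sdiff hV'o)
  obtain ⟨x, -, ⟨y, hyD, rfl⟩, ⟨z, hz, hzy⟩ | hx⟩ :=
    isPreconnected_closed_iff.1 hSc.isPreconnected _ _ h1 h2 (by
      intro x hx
      by_cases hxV : x ∈ V'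
      · by_cases hxD : (⟨x, hx, subset_closure hxV⟩ : K) ∈ D
        · exact .inl ⟨_, hxD, rfl⟩
        · exact .inr (.inl ⟨_, hxD, rfl⟩)
      · exact .inr (.inr ⟨hx, hxV⟩)) ⟨t, hTS.subset ht, t', htD, rfl⟩
      ⟨s, hsS, .inr ⟨hsS, fun h => hsV (hV'V (subset_closure h))⟩⟩
  · exact hz (Subtype.ext hzy ▸ hyD)
  · exact hx.2 (hDV hyD)

/-- The complement of a component of the complement of a continuum is connected. -/
theorem isConnected_compl_connectedComponentIn_compl [PreconnectedSpace X]
    [LocallyConnectedSpace X] {T : Set X} (hT : IsClosed T) (hTc : IsConnected T) (r : X) :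
    IsConnected (connectedComponentIn Tᶜ r)ᶜ := by
  obtain ⟨t, ht⟩ := hTc.nonempty
  have hsub (y : X) : T ⊆ (connectedComponentIn Tᶜ y)ᶜ := fun x hx hx' =>
    connectedComponentIn_subset _ _ hx' hx
  refine ⟨⟨t, hsub r ht⟩, isPreconnected_of_forall t fun y hy => ?_⟩
  by_cases hyT : y ∈ T
  · exact ⟨T, hsub r, ht, hyT, hTc.isPreconnected⟩
  set D := connectedComponentIn Tᶜ y with hD
  have hDo : IsOpen D := hT.isOpen_compl.connectedComponentIn
  have hyD : y ∈ D := mem_connectedComponentIn hyT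
  have hDr : Disjoint D (connectedComponentIn Tᶜ r) := by
    refine Set.disjoint_left.2 fun x hx hx' => hy ?_
    rwa [connectedComponentIn_eq hx', ← connectedComponentIn_eq hx]
  have hmeet : (closure D ∩ T).Nonempty := by
    by_contra hne
    have hcl : closure D ⊆ D :=
      isPreconnected_connectedComponentIn.closure.subset_connectedComponentIn
        (subset_closure hyD) fun x hx hxT => hne ⟨x, hx, hxT⟩
    have hclopen : IsClopen D := ⟨isClosed_of_closure_subset hcl, hDo⟩
    rw [isClopen_iff] at hclopen
    rcases hclopen with h | h
    · rw [h] at hyD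
      exact hyD
    · exact hsub y ht (by rw [← hD, h]; trivial)
  refine ⟨closure D ∪ T, union_subset ?_ (hsub r), .inr ht, .inl (subset_closure hyD), ?_⟩
  · exact fun x hx hx' => (hDr.closure_left hT.isOpen_compl.connectedComponentIn).le_bot ⟨hx, hx'⟩
  · obtain ⟨z, hz, hzT⟩ := hmeet
    exact isPreconnected_connectedComponentIn.closure.union z hz hzT hTc.isPreconnected

/-- Finitely many points of a connected open set lie in a subcontinuum of it. -/
theorem exists_continuum_of_finite_subset [CompactSpace X] [T2Space X] [LocallyConnectedSpace X]
    {U F : Set X} (hU : IsOpen U) (hUc : IsConnected U) (hF : F.Finite) (hFU : F ⊆ U) :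
    ∃ T, IsClosed T ∧ IsConnected T ∧ F ⊆ T ∧ T ⊆ U := by
  have hpair : ∀ x ∈ U, ∀ y ∈ U, ∃ T, IsClosed T ∧ IsPreconnected T ∧ x ∈ T ∧ y ∈ T ∧ T ⊆ U := by
    intro x hx y hy
    refine hUc.isPreconnected.induction₂'
      (fun x y => ∃ T, IsClosed T ∧ IsPreconnected T ∧ x ∈ T ∧ y ∈ T ∧ T ⊆ U) ?_ ?_ hx hy
    · intro x hx
      obtain ⟨V, hVo, hxV, hVU⟩ := normal_exists_closure_subset isClosed_singleton hU
        (singleton_subset_iff.2 hx)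
      obtain ⟨W, hWV, hWo, hxW, hWc⟩ := locallyConnectedSpace_iff_subsets_isOpen_isConnected.1
        inferInstance x V (hVo.mem_nhds (hxV rfl))
      have hcl : closure W ⊆ U := (closure_mono hWV).trans hVU
      filter_upwards [mem_nhdsWithin_of_mem_nhds (hWo.mem_nhds hxW)] with y hy
      have h1 := subset_closure hy
      have h2 := subset_closure hxW
      exact ⟨⟨closure W, isClosed_closure, hWc.isPreconnected.closure, h2, h1, hcl⟩,
        ⟨closure W, isClosed_closure, hWc.isPreconnected.closure, h1, h2, hcl⟩⟩
    · rintro x y z - - - ⟨T, hT, hTc, hxT, hyT, hTU⟩ ⟨T', hT', hTc', hyT', hzT', hTU'⟩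
      exact ⟨T ∪ T', hT.union hT', hTc.union y hyT hyT' hTc', .inl hxT, .inr hzT',
        union_subset hTU hTU'⟩
  obtain ⟨u, hu⟩ := hUc.nonempty
  suffices ∃ T, IsClosed T ∧ IsPreconnected T ∧ u ∈ T ∧ F ⊆ T ∧ T ⊆ U by
    obtain ⟨T, h1, h2, h3, h4, h5⟩ := this
    exact ⟨T, h1, ⟨⟨u, h3⟩, h2⟩, h4, h5⟩
  induction F, hF using Set.Finite.induction_on with
  | empty => exact ⟨{u}, isClosed_singleton, isPreconnected_singleton, rfl, empty_subset _,
      singleton_subset_iff.2 hu⟩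
  | @insert a s ha hs ih =>
    obtain ⟨T, h1, h2, h3, h4, h5⟩ := ih ((subset_insert _ _).trans hFU)
    obtain ⟨T', h1', h2', h3', h4', h5'⟩ := hpair u hu a (hFU (mem_insert _ _))
    exact ⟨T ∪ T', h1.union h1', h2.union u h3 h3' h2', .inl h3,
      insert_subset (.inr h4') (h4.trans subset_union_left), union_subset h5 h5'⟩

/-- If every finite subset of `U` lies in a continuum whose complement has a component containing
the open set `R`, then `R` lies in a single component of the complement of `closure U`. This holds
when NC*(X) is closed in the hyperspace of `X`. -/
def NonseparatingLimits (X : Type*) [TopologicalSpace X] : Prop :=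
  ∀ U R : Set X, IsOpen R → R.Nonempty →
    (∀ F : Set X, F.Finite → F ⊆ U → ∃ T C, IsClosed T ∧ IsConnected T ∧ IsPreconnected C ∧
      F ⊆ T ∧ R ⊆ C ∧ Disjoint C T) →
    ∃ C, IsPreconnected C ∧ R ⊆ C ∧ Disjoint C (closure U)

theorem NonseparatingLimits.exists_preconnected_of_mem_closure [CompactSpace X] [T2Space X]
    [LocallyConnectedSpace X] (hX : NonseparatingLimits X)
    {U R : Set X} (hU : IsOpen U) (hUc : IsConnected U) (hR : IsOpen R) (hRne : R.Nonempty)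
    {q : X} (hq : q ∈ closure U)
    (h : ∀ T ⊆ U, IsClosed T → IsConnected T → ∃ C, IsPreconnected C ∧ R ⊆ C ∧ Disjoint C T) :
    ∃ C, IsPreconnected C ∧ R ⊆ C ∧ q ∉ C := by
  obtain ⟨C, hC, hRC, hCU⟩ := hX U R hR hRne fun F hF hFU => by
    obtain ⟨T, hT, hTc, hFT, hTU⟩ := exists_continuum_of_finite_subset hU hUc hF hFU
    obtain ⟨C, hC, hRC, hCT⟩ := h T hTU hT hTc
    exact ⟨T, C, hT, hTc, hC, hFT, hRC, hCT⟩
  exact ⟨C, hC, hRC, fun hqC => hCU.le_bot ⟨hqC, hq⟩⟩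

/-- If no point of the continuum `T` separates `p` from `q`, then neither does `T`. -/
theorem mem_connectedComponentIn_compl_of_forall_singleton [CompactSpace X] [T2Space X]
    [LocallyConnectedSpace X] (hX : NonseparatingLimits X) {T : Set X} (hT : IsClosed T)
    (hTc : IsConnected T) {p q : X} (hp : p ∉ T)
    (h : ∀ t ∈ T, q ∈ connectedComponentIn {t}ᶜ p) : q ∈ connectedComponentIn Tᶜ p := by
  have hq : q ∉ T := fun hq => connectedComponentIn_subset _ _ (h q hq) rfl
  by_contra hpq
  let 𝓕 : Set (Set X) := {A | A ⊆ T ∧ IsClosed A ∧ IsConnected A ∧ q ∈ connectedComponentIn Aᶜ p}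
  obtain ⟨t, ht⟩ := hTc.nonempty
  obtain ⟨M, -, hM⟩ := zorn_subset_nonempty 𝓕 (by
    intro c hc hchain hne
    refine ⟨closure (⋃₀ c), ?_, fun s hs => (subset_sUnion_of_mem hs).trans subset_closure⟩
    have hdir : DirectedOn (· ⊆ ·) c := hchain.directedOn
    have hUT : ⋃₀ c ⊆ T := sUnion_subset fun s hs => (hc hs).1
    have hcT : closure (⋃₀ c) ⊆ T := closure_minimal hUT hT
    obtain ⟨C, hC, hRC, hCU⟩ := hX (⋃₀ c) (connectedComponentIn Tᶜ p ∪ connectedComponentIn Tᶜ q)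
      (hT.isOpen_compl.connectedComponentIn.union hT.isOpen_compl.connectedComponentIn)
      ⟨p, .inl (mem_connectedComponentIn hp)⟩ (by
        intro F hF hFU
        obtain ⟨A, hA, hFA⟩ := hdir.exists_mem_subset_of_finite_of_subset_sUnion hne hF hFU
        obtain ⟨hAT, hAcl, hAc, hAq⟩ := hc hA
        have hmono := compl_subset_compl.2 hAT
        refine ⟨A, connectedComponentIn Aᶜ p, hAcl, hAc, isPreconnected_connectedComponentIn, hFA,
          union_subset (connectedComponentIn_mono _ hmono) ?_,
          subset_compl_iff_disjoint_right.1 (connectedComponentIn_subset _ _)⟩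
        rw [connectedComponentIn_eq hAq]
        exact connectedComponentIn_mono _ hmono)
    refine ⟨hcT, isClosed_closure, IsConnected.closure ⟨?_, ?_⟩, ?_⟩
    · obtain ⟨s, hs⟩ := hne
      exact (hc hs).2.2.1.nonempty.mono (subset_sUnion_of_mem hs)
    · exact IsPreconnected.sUnion_directed hdir fun s hs => (hc hs).2.2.1.isPreconnected
    · exact hC.subset_connectedComponentIn (hRC (.inl (mem_connectedComponentIn hp)))
        (subset_compl_iff_disjoint_right.2 hCU) (hRC (.inr (mem_connectedComponentIn hq))))
    {t} ⟨singleton_subset_iff.2 ht, isClosed_singleton, isConnected_singleton, h t ht⟩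
  obtain ⟨hMT, hMcl, hMc, hMq⟩ := hM.prop
  have hne : M ≠ T := by rintro rfl; exact hpq hMq
  obtain ⟨K, hK, hKc, hpqK, hKM⟩ := exists_continuum_of_finite_subset
    hMcl.isOpen_compl.connectedComponentIn
    (isConnected_connectedComponentIn_iff.2 fun hpM => hp (hMT hpM))
    (F := {p, q}) (by simp) (pair_subset (mem_connectedComponentIn fun hpM => hp (hMT hpM)) hMq)
  obtain ⟨M', hM'cl, hM'c, hMM', hM'T, hM'K⟩ := exists_larger_subcontinuum hT hTc hMc hMcl
    (hMT.ssubset_of_ne hne) hK.isOpen_compl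
    (fun x hx hxK => connectedComponentIn_subset _ _ (hKM hxK) hx)
  refine hMM'.2 (hM.le_of_ge ⟨hM'T, hM'cl, hM'c, ?_⟩ hMM'.1)
  exact hKc.isPreconnected.subset_connectedComponentIn (hpqK (by simp))
    (fun x hx hxM => hM'K hxM hx) (hpqK (by simp))

end Continua

section Branches

variable {X : Type*} [TopologicalSpace X]

/-- The component of `a` in the complement of the point `q`. -/
def branch (q a : X) : Set X := connectedComponentIn {q}ᶜ a

theorem isPreconnected_branch (q a : X) : IsPreconnected (branch q a) :=
  isPreconnected_connectedComponentIn

theorem mem_branch_self {q a : X} (h : a ≠ q) : a ∈ branch q a :=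
  mem_connectedComponentIn h

theorem self_notMem_branch (q a : X) : q ∉ branch q a := fun h =>
  connectedComponentIn_subset _ _ h rfl

theorem ne_of_mem_branch {q a x : X} (h : x ∈ branch q a) : x ≠ q :=
  connectedComponentIn_subset _ _ h

theorem base_ne_of_mem_branch {q a x : X} (h : x ∈ branch q a) : a ≠ q :=
  connectedComponentIn_nonempty_iff.1 ⟨x, h⟩

theorem branch_eq_of_mem {q a x : X} (h : x ∈ branch q a) : branch q a = branch q x :=
  connectedComponentIn_eq h

theorem mem_branch_symm {q a x : X} (h : x ∈ branch q a) : a ∈ branch q x :=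
  branch_eq_of_mem h ▸ mem_branch_self (base_ne_of_mem_branch h)

theorem IsPreconnected.subset_branch {q a x : X} {C : Set X} (hC : IsPreconnected C)
    (hq : q ∉ C) (hx : x ∈ C) (hxa : x ∈ branch q a) : C ⊆ branch q a := by
  rw [branch_eq_of_mem hxa]
  exact hC.subset_connectedComponentIn hx (subset_compl_singleton_iff.2 hq)

theorem IsPreconnected.mem_branch {q a x : X} {C : Set X} (hC : IsPreconnected C)
    (hq : q ∉ C) (ha : a ∈ C) (hx : x ∈ C) : x ∈ branch q a :=
  hC.subset_branch hq ha (mem_branch_self fun h => hq (h ▸ ha)) hx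

variable [LocallyConnectedSpace X] [T1Space X]

theorem isOpen_branch (q a : X) : IsOpen (branch q a) :=
  isOpen_compl_singleton.connectedComponentIn

theorem closure_branch_subset (q a : X) : closure (branch q a) ⊆ insert q (branch q a) := by
  intro x hx
  by_cases hxq : x = q
  · exact .inl hxq
  obtain ⟨y, hy, hya⟩ := mem_closure_iff.1 hx _ (isOpen_branch q x) (mem_branch_self hxq)
  rw [branch_eq_of_mem hya, ← branch_eq_of_mem hy]
  exact .inr (mem_branch_self hxq)

variable [ConnectedSpace X]

theorem isConnected_compl_branch (q a : X) : IsConnected (branch q a)ᶜ :=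
  isConnected_compl_connectedComponentIn_compl isClosed_singleton isConnected_singleton a

theorem mem_closure_branch {q a : X} (h : a ≠ q) : q ∈ closure (branch q a) := by
  by_contra hq
  have hcl : closure (branch q a) ⊆ branch q a :=
    (isPreconnected_branch q a).closure.subset_branch hq (subset_closure (mem_branch_self h))
      (mem_branch_self h)
  rcases isClopen_iff.1 ⟨isClosed_of_closure_subset hcl, isOpen_branch q a⟩ with h' | h'
  · exact (h' ▸ mem_branch_self h : a ∈ (∅ : Set X))
  · exact self_notMem_branch q a (h' ▸ mem_univ q)

theorem isPreconnected_insert_branch {q a : X} (h : a ≠ q) :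
    IsPreconnected (insert q (branch q a)) :=
  (isPreconnected_branch q a).subset_closure (subset_insert _ _)
    (insert_subset (mem_closure_branch h) subset_closure)

theorem branch_subset_or_subset {a b q r : X} (hq : q ≠ a) (hbq : b ∉ branch q a)
    (hbr : b ∉ branch r a) : branch q a ⊆ branch r a ∨ branch r a ⊆ branch q a := by
  by_cases hrq : r ∈ branch q a
  · refine .inr fun x hx => not_not.1 fun hxq => hbr ?_
    exact (isConnected_compl_branch q a).isPreconnected.subset_branch (not_not.2 hrq) hxq hx hbq
  · rcases eq_or_ne q r with rfl | hne
    · exact .inl Subset.rfl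
    have h := (isPreconnected_branch q a).subset_branch (q := r) (a := a) hrq
      (mem_branch_self hq.symm)
    refine .inl (h (mem_branch_self ?_))
    rintro rfl
    exact hrq (mem_branch_self hq.symm)

/-- The points separating `a` from `{b, c}` have a last element, if neither of `b` and `c`
separates `a` from the other one. -/
theorem exists_maximal_branch [T2Space X] {a b c q : X} (hb : c ∈ branch b a)
    (hc : b ∈ branch c a) (hqa : q ≠ a) (hqb : b ∉ branch q a) (hqc : c ∉ branch q a) :
    ∃ z, z ≠ a ∧ b ∉ branch z a ∧ c ∉ branch z a ∧
      ∀ r, r ≠ a → b ∉ branch r a → c ∉ branch r a → branch r a ⊆ branch z a := by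
  let G : Set X := {r | r ≠ a ∧ b ∉ branch r a ∧ c ∉ branch r a}
  set U := ⋃ r ∈ G, branch r a with hU
  have haU : a ∈ U := mem_biUnion (show q ∈ G from ⟨hqa, hqb, hqc⟩) (mem_branch_self hqa.symm)
  have hbU : b ∉ U := by simp only [hU, mem_iUnion, not_exists]; exact fun r hr => hr.2.1
  have hcU : c ∉ U := by simp only [hU, mem_iUnion, not_exists]; exact fun r hr => hr.2.2
  have hUo : IsOpen U := isOpen_biUnion fun r _ => isOpen_branch r a
  have hUc : IsPreconnected U := by
    refine isPreconnected_of_forall a fun y hy => ?_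
    obtain ⟨r, hr, hyr⟩ := mem_iUnion₂.1 hy
    exact ⟨branch r a, subset_biUnion_of_mem (u := fun r => branch r a) hr,
      mem_branch_self hr.1.symm, hyr, isPreconnected_branch r a⟩
  have hlim : ∀ z ∈ closure U \ U, ∀ V, IsOpen V → z ∈ V →
      ∃ r ∈ G, ∀ s ∈ G, branch r a ⊆ branch s a → s ∈ V := by
    rintro z ⟨hz, hzU⟩ V hV hzV
    obtain ⟨W, hWV, hWo, hzW, hWc⟩ := locallyConnectedSpace_iff_subsets_isOpen_isConnected.1
      inferInstance z V (hV.mem_nhds hzV)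
    obtain ⟨x, hxW, hxU⟩ := mem_closure_iff.1 hz W hWo hzW
    obtain ⟨r, hr, hxr⟩ := mem_iUnion₂.1 hxU
    refine ⟨r, hr, fun s hs hrs => hWV (not_not.1 fun hsW => hzU ?_)⟩
    exact mem_biUnion hs (hWc.isPreconnected.subset_branch hsW hxW (hrs hxr) hzW)
  have huniq : ∀ z ∈ closure U \ U, ∀ z' ∈ closure U \ U, z = z' := by
    intro z hz z' hz'
    by_contra hne
    obtain ⟨V, V', hV, hV', hzV, hzV', hVV'⟩ := t2_separation hne
    obtain ⟨r, hr, hrV⟩ := hlim z hz V hV hzV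
    obtain ⟨r', hr', hrV'⟩ := hlim z' hz' V' hV' hzV'
    rcases branch_subset_or_subset hr.1 hr.2.1 hr'.2.1 with h | h
    · exact hVV'.le_bot ⟨hrV r' hr' h, hrV' r' hr' Subset.rfl⟩
    · exact hVV'.le_bot ⟨hrV r hr Subset.rfl, hrV' r hr h⟩
  obtain ⟨z, hz⟩ : (closure U \ U).Nonempty := by
    by_contra hne
    have hcl : closure U ⊆ U := sdiff_eq_empty.1 (not_nonempty_iff_eq_empty.1 hne)
    rcases isClopen_iff.1 ⟨isClosed_of_closure_subset hcl, hUo⟩ with h | h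
    · exact (h ▸ haU : a ∈ (∅ : Set X))
    · exact hbU (h ▸ mem_univ b)
  have hza : z ≠ a := by rintro rfl; exact hz.2 haU
  have hzU : branch z a = U := by
    apply Subset.antisymm
    · refine (isPreconnected_branch z a).subset_left_of_subset_union hUo
        isClosed_closure.isOpen_compl (disjoint_compl_right.mono_left subset_closure) ?_
        ⟨a, mem_branch_self hza.symm, haU⟩
      intro x hx
      by_contra hxU
      simp only [mem_union, mem_compl_iff, not_or, not_not] at hxU
      exact ne_of_mem_branch hx (huniq x hxU.symm z hz)
    · exact hUc.subset_branch hz.2 haU (mem_branch_self hza.symm)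
  refine ⟨z, hza, hzU ▸ hbU, hzU ▸ hcU, fun r h1 h2 h3 => ?_⟩
  rw [hzU]
  exact subset_biUnion_of_mem (u := fun r => branch r a) (show r ∈ G from ⟨h1, h2, h3⟩)

variable [CompactSpace X] [T2Space X]

/-- The complement of a point has at most two components. -/
theorem NonseparatingLimits.mem_branch (hX : NonseparatingLimits X) {q a b c : X} (ha : a ≠ q)
    (hb : b ≠ q) (hc : c ≠ q) (hba : b ∉ branch q a) (hca : c ∉ branch q a) :
    c ∈ branch q b := by
  have hsub {x : X} (hx : x ≠ q) (hxa : x ∉ branch q a) : branch q x ⊆ (branch q a)ᶜ :=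
    fun y hy hya => hxa (by rw [branch_eq_of_mem hya, ← branch_eq_of_mem hy]; exact mem_branch_self hx)
  obtain ⟨C, hC, hRC, hqC⟩ := hX.exists_preconnected_of_mem_closure (isOpen_branch q a)
    ⟨⟨a, mem_branch_self ha⟩, isPreconnected_branch q a⟩
    ((isOpen_branch q b).union (isOpen_branch q c)) ⟨b, .inl (mem_branch_self hb)⟩
    (mem_closure_branch ha) fun T hT _ _ => ⟨(branch q a)ᶜ,
      (isConnected_compl_branch q a).isPreconnected, union_subset (hsub hb hba) (hsub hc hca),
      disjoint_compl_left.mono_right hT⟩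
  exact hC.mem_branch hqC (hRC (.inl (mem_branch_self hb))) (hRC (.inr (mem_branch_self hc)))

/-- A cut point `p` is separated by a point from every other point. -/
theorem NonseparatingLimits.exists_separating (hX : NonseparatingLimits X) {p b u : X}
    (hb : b ≠ p) (hu : u ≠ p) (hub : u ∉ branch p b) :
    ∃ q, q ≠ p ∧ q ≠ b ∧ b ∉ branch q p := by
  by_contra! hcon
  obtain ⟨V, hVo, hbV, hVp⟩ := normal_exists_closure_subset isClosed_singleton
    (isOpen_compl_singleton (x := p)) (singleton_subset_iff.2 hb)
  obtain ⟨W, hWV, hWo, hbW, hWc⟩ := locallyConnectedSpace_iff_subsets_isOpen_isConnected.1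
    inferInstance b V (hVo.mem_nhds (hbV rfl))
  have hpW : p ∉ closure W := fun h => hVp (closure_mono hWV h) rfl
  set C := connectedComponentIn (closure W)ᶜ p with hC
  have hCo : IsOpen C := isClosed_closure.isOpen_compl.connectedComponentIn
  have hpC : p ∈ C := mem_connectedComponentIn hpW
  have hCW : C ⊆ (closure W)ᶜ := connectedComponentIn_subset _ _
  obtain ⟨x, hxC, hxP⟩ := mem_closure_iff.1 (mem_closure_branch hb) C hCo hpC
  have hCPo : IsOpen (C ∩ branch p b) := hCo.inter (isOpen_branch p b)
  set U := connectedComponentIn (C ∩ branch p b) x with hU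
  have hUo : IsOpen U := hCPo.connectedComponentIn
  have hxU : x ∈ U := mem_connectedComponentIn ⟨hxC, hxP⟩
  have hUCP : U ⊆ C ∩ branch p b := connectedComponentIn_subset _ _
  have hUp : IsPreconnected U := isPreconnected_connectedComponentIn
  have hpU : p ∈ closure U := by
    by_contra hpU
    have hsub : C ⊆ U ∪ (closure U)ᶜ := by
      intro y hyC
      by_contra hy
      simp only [mem_union, mem_compl_iff, not_or, not_not] at hy
      have hyP : y ∈ branch p b := by
        rcases closure_branch_subset p b
          (closure_mono (hUCP.trans inter_subset_right) hy.2) with rfl | h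
        · exact absurd hy.2 hpU
        · exact h
      have : IsPreconnected (closure U ∩ (C ∩ branch p b)) :=
        hUp.subset_closure (subset_inter subset_closure hUCP) inter_subset_left
      exact hy.1 (this.subset_connectedComponentIn ⟨subset_closure hxU, hUCP hxU⟩
        inter_subset_right ⟨hy.2, hyC, hyP⟩)
    have := (isPreconnected_connectedComponentIn (x := p) (F := (closure W)ᶜ)).subset_left_of_subset_union
      hUo isClosed_closure.isOpen_compl (disjoint_compl_right.mono_left subset_closure) hsub
      ⟨x, hxC, hxU⟩
    exact hpU (subset_closure (this hpC))
  obtain ⟨D, hD, hRD, hpD⟩ := hX.exists_preconnected_of_mem_closure hUo ⟨⟨x, hxU⟩, hUp⟩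
    (hWo.union (isOpen_branch p u)) ⟨b, .inl hbW⟩ hpU (by
      intro T hTU hT hTc
      have hpT : p ∉ T := fun h => self_notMem_branch p b (hUCP (hTU h)).2
      have hWT : W ⊆ Tᶜ := fun y hy hyT => hCW (hUCP (hTU hyT)).1 (subset_closure hy)
      have hbT := mem_connectedComponentIn_compl_of_forall_singleton hX hT hTc hpT (q := b)
        fun t ht => hcon t (fun h => hpT (h ▸ ht)) fun h => hWT hbW (h ▸ ht)
      refine ⟨connectedComponentIn Tᶜ p, isPreconnected_connectedComponentIn,
        union_subset ?_ ?_, subset_compl_iff_disjoint_right.1 (connectedComponentIn_subset _ _)⟩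
      · rw [connectedComponentIn_eq hbT]
        exact hWc.isPreconnected.subset_connectedComponentIn hbW hWT
      · refine (subset_insert p _).trans ((isPreconnected_insert_branch hu).subset_connectedComponentIn
          (mem_insert _ _) (insert_subset hpT fun y hy hyT => hub ?_))
        rw [branch_eq_of_mem (hUCP (hTU hyT)).2]
        exact mem_branch_symm hy)
  exact hub (hD.mem_branch hpD (hRD (.inl hbW)) (hRD (.inr (mem_branch_self hu))))

/-- Among three points, none of which separates the two others, no two are separated from the third
one by a point. -/
theorem NonseparatingLimits.not_separated_triple (hX : NonseparatingLimits X) {a b c q : X}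
    (hb : c ∈ branch b a) (hc : b ∈ branch c a) (ha : c ∈ branch a b)
    (hqa : q ≠ a) (hqb : b ∉ branch q a) (hqc : c ∉ branch q a) : False := by
  obtain ⟨z, hza, hzb, hzc, hzmax⟩ := exists_maximal_branch hb hc hqa hqb hqc
  have hbz : b ≠ z := by rintro rfl; exact hzc hb
  have hcz : c ≠ z := by rintro rfl; exact hzb hc
  obtain ⟨y, hyz, hyb, hby⟩ := hX.exists_separating hbz hza.symm fun h => hzb (mem_branch_symm h)
  have hya : y ∉ branch z a := fun h => hby <|
    (isConnected_compl_branch z a).isPreconnected.mem_branch (not_not.2 h)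
      (self_notMem_branch z a) hzb
  have hzy : z ∈ branch y a := (isPreconnected_insert_branch hza.symm).mem_branch
    (by rintro (h | h); exacts [hyz h, hya h]) (.inr (mem_branch_self hza.symm)) (mem_insert _ _)
  have hyna : y ≠ a := by rintro rfl; exact hya (mem_branch_self hza.symm)
  rw [← branch_eq_of_mem hzy] at hby
  have hcy : c ∈ branch y a := not_not.1 fun h =>
    self_notMem_branch z a (hzmax y hyna hby h hzy)
  obtain ⟨z', hz'b, hz'a, hz'c, hz'max⟩ := exists_maximal_branch ha (mem_branch_symm hc)
    hyb (fun h => hby (mem_branch_symm h))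
    (fun h => hby (branch_eq_of_mem hcy ▸ mem_branch_symm h))
  have hzz' : z' ≠ z := by
    rintro rfl
    exact hz'c (hX.mem_branch hza.symm hbz hcz hzb hzc)
  have hz'z : z' ∉ branch z a := fun h => hz'c <|
    (isConnected_compl_branch z a).isPreconnected.mem_branch (not_not.2 h) hzb hzc
  have hzz : z ∉ branch z' b := fun h => hzc <|
    (isConnected_compl_branch z' b).isPreconnected.mem_branch (not_not.2 h) hz'a hz'c
  obtain ⟨w, hwz, hwz', hw⟩ := hX.exists_separating hzz' hza.symm fun h =>
    hz'z (mem_branch_symm h)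
  have hwa : w ∉ branch z a := fun h => hw <|
    (isConnected_compl_branch z a).isPreconnected.mem_branch (not_not.2 h)
      (self_notMem_branch z a) hz'z
  have hwb : w ∉ branch z' b := fun h => hw <|
    (isConnected_compl_branch z' b).isPreconnected.mem_branch (not_not.2 h)
      hzz (self_notMem_branch z' b)
  have hzw : z ∈ branch w a := (isPreconnected_insert_branch hza.symm).mem_branch
    (by rintro (h | h); exacts [hwz h, hwa h]) (.inr (mem_branch_self hza.symm)) (mem_insert _ _)
  have hz'w : z' ∈ branch w b := (isPreconnected_insert_branch hz'b.symm).mem_branch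
    (by rintro (h | h); exacts [hwz' h, hwb h]) (.inr (mem_branch_self hz'b.symm)) (mem_insert _ _)
  have hbw : b ∉ branch w a := fun h => hw <| by
    rw [← branch_eq_of_mem hzw, branch_eq_of_mem h]
    exact hz'w
  by_cases hcw : c ∈ branch w a
  · refine self_notMem_branch z' b (hz'max w ?_ (fun h => hbw (mem_branch_symm h))
      (fun h => hbw ?_) hz'w)
    · rintro rfl
      exact hwb (mem_branch_self hz'b.symm)
    · exact branch_eq_of_mem hcw ▸ mem_branch_symm h
  · refine self_notMem_branch z a (hzmax w ?_ hbw hcw hzw)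
    rintro rfl
    exact hwa (mem_branch_self hza.symm)

/-- If two non-cut points are separated by some point, they are separated by every other point. -/
theorem NonseparatingLimits.notMem_branch_of_noncut (hX : NonseparatingLimits X) {o e p : X}
    (ho : IsPreconnected ({o}ᶜ : Set X)) (he : IsPreconnected ({e}ᶜ : Set X))
    (hpo : p ≠ o) (hpe : p ≠ e) (hp : e ∉ branch p o) {x : X} (hxo : x ≠ o)
    (hxe : x ≠ e) : e ∉ branch x o := by
  intro hx
  have hoe : o ≠ e := by rintro rfl; exact hp (mem_branch_self hpo.symm)
  have h1 : e ∈ branch o x := ho.mem_branch (not_not.2 rfl) hxo hoe.symm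
  have h2 : o ∈ branch e x := he.mem_branch (not_not.2 rfl) hxe hoe
  by_cases hxp : x ∈ branch p o
  · exact hX.not_separated_triple (mem_branch_symm hx) (mem_branch_symm h1) h2 hpe
      (fun h => hp (branch_eq_of_mem hxp ▸ mem_branch_symm h)) (fun h => hp (mem_branch_symm h))
  · exact hX.not_separated_triple hx (mem_branch_symm h2) h1 hpo hxp hp

end Branches

section Hyperspace

open Metric

variable {X : Type*} [MetricSpace X]

theorem continuous_coe_NCstar : Continuous ((↑) : NCstar X → NonemptyCompacts X) :=
  continuous_subtype_val

variable [CompactSpace X]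

/-- A Whitney map, with the order reversed. -/
theorem exists_continuous_strictAnti_nonemptyCompacts [Nonempty X] :
    ∃ w : NonemptyCompacts X → ℝ, Continuous w ∧ StrictAnti w := by
  have hle (n : ℕ) (A : NonemptyCompacts X) :
      infDist (denseSeq X n) A ≤ diam (univ : Set X) := by
    obtain ⟨a, ha⟩ := A.nonempty
    exact (infDist_le_dist_of_mem ha).trans
      (dist_le_diam_of_mem isCompact_univ.isBounded (mem_univ _) (mem_univ _))
  have hbd (n : ℕ) (A : NonemptyCompacts X) :
      ‖(1 / 2 : ℝ) ^ n * infDist (denseSeq X n) A‖ ≤ (1 / 2) ^ n * diam (univ : Set X) := by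
    rw [Real.norm_of_nonneg (mul_nonneg (by positivity) infDist_nonneg)]
    exact mul_le_mul_of_nonneg_left (hle n A) (by positivity)
  have hsum : Summable fun n : ℕ => (1 / 2 : ℝ) ^ n * diam (univ : Set X) :=
    summable_geometric_two.mul_right _
  have hsum' (A : NonemptyCompacts X) :
      Summable fun n : ℕ => (1 / 2 : ℝ) ^ n * infDist (denseSeq X n) A :=
    hsum.of_norm_bounded (hbd · A)
  refine ⟨fun A => ∑' n : ℕ, (1 / 2 : ℝ) ^ n * infDist (denseSeq X n) A, ?_, fun A B hAB => ?_⟩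
  · exact continuous_tsum
      (fun n => continuous_const.mul (lipschitz_infDist_set _).continuous)
      hsum hbd
  · obtain ⟨hsub, b, hbB, hbA⟩ := SetLike.lt_iff_le_and_exists.1 hAB
    have hpos : 0 < infDist b A := (A.isCompact.isClosed.notMem_iff_infDist_pos A.nonempty).1 hbA
    obtain ⟨n, hn⟩ := (denseRange_denseSeq X).exists_dist_lt b (half_pos hpos)
    refine Summable.tsum_lt_tsum (i := n) (fun k => ?_) ?_ (hsum' B) (hsum' A)
    · exact mul_le_mul_of_nonneg_left (infDist_le_infDist_of_subset hsub A.nonempty)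
        (by positivity)
    · refine mul_lt_mul_of_pos_left ?_ (by positivity)
      have h1 : infDist (denseSeq X n) B ≤ dist b (denseSeq X n) := by
        rw [dist_comm]
        exact infDist_le_dist_of_mem hbB
      have h2 : infDist b A ≤ infDist (denseSeq X n) A + dist b (denseSeq X n) :=
        infDist_le_infDist_add_dist
      linarith

/-- A continuum with connected complement, as a point of NC*(X). -/
def NCstar.mk (T : Set X) (hT : IsClosed T) (hTc : IsConnected T) (hc : IsPreconnected Tᶜ) :
    NCstar X :=
  ⟨⟨⟨T, hT.isCompact⟩, hTc.nonempty⟩, hTc, hc⟩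

variable [ConnectedSpace X]

/-- If no continuum separates `X`, then the continua meeting a closed set form a continuum
in NC*(X). -/
theorem isPreconnected_inter_nonempty_of_forall_compl [CompactSpace (NCstar X)]
    (hsep : ∀ T : Set X, IsClosed T → IsConnected T → IsPreconnected Tᶜ) {B : Set X}
    (hB : IsClosed B) : IsPreconnected {A : NCstar X | ((A.1 : Set X) ∩ B).Nonempty} := by
  obtain ⟨w, hw, hwanti⟩ := exists_continuous_strictAnti_nonemptyCompacts (X := X)
  set S := {A : NCstar X | ((A.1 : Set X) ∩ B).Nonempty} with hS
  have hScl : IsClosed S :=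
    (NonemptyCompacts.isClosed_inter_nonempty_of_isClosed hB).preimage continuous_coe_NCstar
  let top : NCstar X := NCstar.mk univ isClosed_univ isConnected_univ
    (by rw [compl_univ]; exact isPreconnected_empty)
  have key : ∀ u v : Set (NCstar X), IsOpen u → IsOpen v → S ⊆ u ∪ v → top ∈ u →
      (S ∩ v).Nonempty → (S ∩ (u ∩ v)).Nonempty := by
    rintro u v hu hv hSuv htop ⟨A₀, hA₀S, hA₀v⟩
    by_contra hne
    have hvu : ∀ A ∈ S, A ∈ v → A ∉ u := fun A hAS hAv hAu => hne ⟨A, hAS, hAu, hAv⟩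
    obtain ⟨A, ⟨hAS, hAu⟩, hAmin⟩ := (hScl.sdiff hu).isCompact.exists_isMinOn
      ⟨A₀, hA₀S, hvu A₀ hA₀S hA₀v⟩ (hw.comp continuous_coe_NCstar).continuousOn
    have hAv : A ∈ v := (hSuv hAS).resolve_left hAu
    have hAtop : (A.1 : Set X) ≠ univ := fun h => hAu <| by
      have : A = top := Subtype.ext (SetLike.coe_injective h)
      rwa [this]
    obtain ⟨ε, hε, hball⟩ := Metric.isOpen_iff.1 hv A hAv
    obtain ⟨T, hT, hTc, hAT, -, hTε⟩ := exists_larger_subcontinuum isClosed_univ isConnected_univ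
      A.2.1 A.1.isCompact.isClosed (ssubset_univ_iff.2 hAtop) (isOpen_thickening (δ := ε / 2))
      (self_subset_thickening (half_pos hε) _)
    let A' : NCstar X := NCstar.mk T hT hTc (hsep T hT hTc)
    have hA'v : A' ∈ v := hball <| by
      refine lt_of_le_of_lt (hausdorffDist_le_of_mem_dist (half_pos hε).le ?_ ?_) (half_lt_self hε)
      · intro x hx
        obtain ⟨y, hy, hxy⟩ := mem_thickening_iff.1 (hTε hx)
        exact ⟨y, hy, hxy.le⟩
      · exact fun x hx => ⟨x, hAT.1 hx, by rw [dist_self]; exact (half_pos hε).le⟩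
    have hA'S : A' ∈ S := hAS.mono (inter_subset_inter_left _ hAT.1)
    exact (hwanti (show A.1 < A'.1 from hAT)).not_ge (hAmin ⟨hA'S, hvu A' hA'S hA'v⟩)
  rintro u v hu hv hSuv hSu hSv
  have htopS : top ∈ S := by
    obtain ⟨A, ⟨x, -, hx⟩, -⟩ := id hSu
    exact ⟨x, mem_univ x, hx⟩
  rcases hSuv htopS with h | h
  · exact key u v hu hv hSuv h hSv
  · rw [inter_comm u v]
    exact key v u hv hu (union_comm u v ▸ hSuv) h hSu

variable [LocallyConnectedSpace X]

theorem nonseparatingLimits_of_compactSpace [CompactSpace (NCstar X)] :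
    NonseparatingLimits X := by
  rintro U R hR ⟨r, hr⟩ h
  let Z (x : U) : Set (NCstar X) := {A | ((A.1 : Set X) ∩ {x.1}).Nonempty}
  let D : Set (NCstar X) := {A | (A.1 : Set X) ⊆ Rᶜ}
  have hD : IsClosed D :=
    (NonemptyCompacts.isClosed_subsets_of_isClosed hR.isClosed_compl).preimage
      continuous_coe_NCstar
  have hZ (x : U) : IsClosed (Z x) :=
    (NonemptyCompacts.isClosed_inter_nonempty_of_isClosed isClosed_singleton).preimage
      continuous_coe_NCstar
  obtain ⟨A, hAD, hAZ⟩ := hD.isCompact.inter_iInter_nonempty Z hZ fun u => by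
    obtain ⟨T, C, hT, hTc, hC, hFT, hRC, hCT⟩ := h ((↑) '' (u : Set U)) (u.finite_toSet.image _)
      (by rintro _ ⟨x, -, rfl⟩; exact x.2)
    have hCc : C ⊆ connectedComponentIn Tᶜ r :=
      hC.subset_connectedComponentIn (hRC hr) (subset_compl_iff_disjoint_right.2 hCT)
    refine ⟨NCstar.mk (connectedComponentIn Tᶜ r)ᶜ
      hT.isOpen_compl.connectedComponentIn.isClosed_compl
      (isConnected_compl_connectedComponentIn_compl hT hTc r)
      (by rw [compl_compl]; exact isPreconnected_connectedComponentIn),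
      compl_subset_compl.2 (hRC.trans hCc), mem_iInter₂.2 fun x hx => ⟨x, ?_, rfl⟩⟩
    exact fun h => connectedComponentIn_subset _ _ h (hFT ⟨x, hx, rfl⟩)
  have hUA : U ⊆ A.1 := fun x hx => by
    obtain ⟨y, hy, rfl⟩ := mem_iInter.1 hAZ ⟨x, hx⟩
    exact hy
  exact ⟨(A.1 : Set X)ᶜ, A.2.2, subset_compl_comm.1 hAD,
    disjoint_compl_left.mono_right (closure_minimal hUA A.1.isCompact.isClosed)⟩

/-- Some point of `X` is a cut point. -/
theorem exists_separating_of_homeomorph [Nontrivial X] (h : X ≃ₜ NCstar X) :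
    ∃ q a b : X, a ≠ q ∧ b ≠ q ∧ b ∉ branch q a := by
  have : CompactSpace (NCstar X) := h.compactSpace
  have hX : NonseparatingLimits X := nonseparatingLimits_of_compactSpace
  by_contra! hcon
  have hsep (T : Set X) (hT : IsClosed T) (hTc : IsConnected T) : IsPreconnected Tᶜ := by
    refine isPreconnected_of_forall_pair fun p hp q hq => ⟨connectedComponentIn Tᶜ p,
      connectedComponentIn_subset _ _, mem_connectedComponentIn hp, ?_,
      isPreconnected_connectedComponentIn⟩
    exact mem_connectedComponentIn_compl_of_forall_singleton hX hT hTc hp fun t ht =>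
      hcon t p q (fun h => hp (h ▸ ht)) fun h => hq (h ▸ ht)
  obtain ⟨a, b, hab⟩ := exists_pair_ne X
  set r := dist b a / 2 with hr
  have hr0 : 0 < r := half_pos (dist_pos.2 hab.symm)
  have hbr : r < dist b a := half_lt_self (dist_pos.2 hab.symm)
  let pt (x : X) : NCstar X := NCstar.mk {x} isClosed_singleton isConnected_singleton
    (hsep _ isClosed_singleton isConnected_singleton)
  set S := {A : NCstar X | ((A.1 : Set X) ∩ sphere a r).Nonempty} with hS
  have hScl : IsClosed S :=
    (NonemptyCompacts.isClosed_inter_nonempty_of_isClosed isClosed_sphere).preimage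
      continuous_coe_NCstar
  obtain ⟨x, hx⟩ : ∃ x, dist x a = r := mem_range_of_exists_le_of_exists_ge
    (continuous_id.dist continuous_const) ⟨a, by simp [hr0.le]⟩ ⟨b, hbr.le⟩
  have hSc : IsConnected S :=
    ⟨⟨pt x, x, rfl, hx⟩, isPreconnected_inter_nonempty_of_forall_compl hsep isClosed_sphere⟩
  have hScompl : IsPreconnected Sᶜ := by
    have := hsep (h ⁻¹' S) (hScl.preimage h.continuous)
      (by rw [← h.image_symm]; exact hSc.image _ h.symm.continuous.continuousOn)
    have := this.image h h.continuous.continuousOn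
    rwa [← preimage_compl, h.image_preimage] at this
  have hopen {V : Set X} (hV : IsOpen V) : IsOpen {A : NCstar X | (A.1 : Set X) ⊆ V} :=
    (NonemptyCompacts.isOpen_subsets_of_isOpen hV).preimage continuous_coe_NCstar
  have hO1 : IsOpen {y | dist y a < r} := isOpen_lt (by fun_prop) (by fun_prop)
  have hO2 : IsOpen {y | r < dist y a} := isOpen_lt (by fun_prop) (by fun_prop)
  have hdisj : Disjoint {y | dist y a < r} {y | r < dist y a} :=
    Set.disjoint_left.2 fun y (hy : dist y a < r) (hy' : r < dist y a) => lt_asymm hy hy'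
  obtain ⟨A, -, hA1, hA2⟩ := hScompl _ _ (hopen hO1) (hopen hO2) (by
      intro A hA
      have hcov : (A.1 : Set X) ⊆ {y | dist y a < r} ∪ {y | r < dist y a} := fun y hy =>
        lt_or_gt_of_ne fun h => hA ⟨y, hy, h⟩
      exact A.2.1.isPreconnected.subset_or_subset hO1 hO2 hdisj hcov)
    ⟨pt a, by rintro ⟨y, rfl, hy⟩; simp [hr0.ne] at hy, by
      rintro y rfl; simpa using hr0⟩
    ⟨pt b, by rintro ⟨y, rfl, hy⟩; exact hbr.ne' hy, by rintro y rfl; exact hbr⟩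
  obtain ⟨y, hy⟩ := A.1.nonempty
  exact hdisj.le_bot ⟨hA1 hy, hA2 hy⟩

/-- Every proper element of NC*(X) contains a non-cut point of `X`. -/
theorem exists_noncut_mem [CompactSpace (NCstar X)] (A : NCstar X) {r : X}
    (hr : r ∉ (A.1 : Set X)) : ∃ o ∈ (A.1 : Set X), IsPreconnected ({o}ᶜ : Set X) := by
  obtain ⟨w, hw, hwanti⟩ := exists_continuous_strictAnti_nonemptyCompacts (X := X)
  have hcl : IsClosed {A' : NCstar X | (A'.1 : Set X) ⊆ A.1} :=
    (NonemptyCompacts.isClosed_subsets_of_isClosed A.1.isCompact.isClosed).preimage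
      continuous_coe_NCstar
  obtain ⟨M, hMA, hMmax⟩ := hcl.isCompact.exists_isMaxOn ⟨A, Subset.rfl⟩
    (hw.comp continuous_coe_NCstar).continuousOn
  have hbranch : ∀ a ∈ (M.1 : Set X), branch a r = (M.1 : Set X)ᶜ := by
    intro a ha
    have hsub : (branch a r)ᶜ ⊆ (M.1 : Set X) := compl_subset_comm.1 <|
      M.2.2.subset_branch (not_not.2 ha) (fun h => hr (hMA h))
        (mem_branch_self fun h => hr (hMA (h ▸ ha)))
    by_contra hne
    let M' : NCstar X := NCstar.mk (branch a r)ᶜ (isOpen_branch a r).isClosed_compl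
      (isConnected_compl_branch a r) (by rw [compl_compl]; exact isPreconnected_branch a r)
    have hlt : M'.1 < M.1 :=
      hsub.ssubset_of_ne fun h => hne (by rw [← h, compl_compl])
    exact (hwanti hlt).not_ge (hMmax (show (M'.1 : Set X) ⊆ A.1 from hsub.trans hMA))
  obtain ⟨o, ho⟩ := M.1.nonempty
  have hMo : (M.1 : Set X) = {o} := by
    refine Subset.antisymm (fun a ha => ?_) (singleton_subset_iff.2 ho)
    have h1 := mem_closure_branch (q := a) (a := r) fun h => hr (hMA (h ▸ ha))
    rw [hbranch a ha, ← hbranch o ho] at h1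
    refine (closure_branch_subset o r h1).resolve_right fun h2 => ?_
    rw [hbranch o ho] at h2
    exact h2 ha
  exact ⟨o, hMA ho, hMo ▸ M.2.2⟩

/-- A homeomorphism onto the unit interval from an injective real function. -/
theorem nonempty_homeomorph_unitInterval_of_injective {Y : Type*} [TopologicalSpace Y]
    [CompactSpace Y] [ConnectedSpace Y] [Nontrivial Y] {f : Y → ℝ} (hf : Continuous f)
    (hinj : Function.Injective f) : Nonempty (Y ≃ₜ unitInterval) := by
  have hrange := eq_Icc_of_connected_compact (isConnected_range hf) (isCompact_range hf)
  set m := sInf (range f)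
  set M := sSup (range f)
  have hmem (y : Y) : f y ∈ Icc m M := hrange ▸ mem_range_self y
  have hlt : m < M := by
    obtain ⟨x, y, hxy⟩ := exists_pair_ne Y
    by_contra! hle
    exact hxy (hinj (le_antisymm ((hmem x).2.trans (hle.trans (hmem y).1))
      ((hmem y).2.trans (hle.trans (hmem x).1))))
  exact ⟨((hf.isClosedEmbedding hinj).isEmbedding.toHomeomorph.trans
    (Homeomorph.setCongr hrange)).trans (iccHomeoI m M hlt)⟩

end Hyperspace

/-- A locally connected continuum homeomorphic to its hyperspace NC*(X)
is homeomorphic to [0,1]. -/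
theorem stmt3 {X : Type*} [MetricSpace X] [CompactSpace X] [ConnectedSpace X] [Nontrivial X]
    [LocallyConnectedSpace X] (h : Nonempty (X ≃ₜ NCstar X)) :
    Nonempty (X ≃ₜ unitInterval) := by
  obtain ⟨h⟩ := h
  have : CompactSpace (NCstar X) := h.compactSpace
  have hX : NonseparatingLimits X := nonseparatingLimits_of_compactSpace
  obtain ⟨p, a, b, hap, hbp, hab⟩ := exists_separating_of_homeomorph h
  let coBranch (x : X) : NCstar X := NCstar.mk (branch p x)ᶜ (isOpen_branch p x).isClosed_compl
    (isConnected_compl_branch p x) (by rw [compl_compl]; exact isPreconnected_branch p x)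
  -- two non-cut points `o`, `e` on different sides of `p`
  have hnoncut {x : X} (hx : x ≠ p) : ∃ o ∉ branch p x, IsPreconnected ({o}ᶜ : Set X) :=
    exists_noncut_mem (coBranch x) (r := x) (not_not.2 (mem_branch_self hx))
  have hcut : ∀ o : X, IsPreconnected ({o}ᶜ : Set X) → o ≠ p := by
    rintro o ho rfl
    exact hab (ho.mem_branch (not_not.2 rfl) hap hbp)
  obtain ⟨o, -, ho⟩ := hnoncut hap
  obtain ⟨e, hepo, he⟩ := hnoncut (hcut o ho)
  have hbtw {x : X} (hxo : x ≠ o) (hxe : x ≠ e) : e ∉ branch x o :=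
    hX.notMem_branch_of_noncut ho he (hcut o ho).symm (hcut e he).symm hepo hxo hxe
  -- every element of NC*(X) contains `o` or `e`, and only `X` contains both
  have hor (A : NCstar X) : o ∈ A.1 ∨ e ∈ A.1 := by
    by_contra! hA
    obtain ⟨x, hx⟩ := A.1.nonempty
    exact hbtw (x := x) (fun h => hA.1 (h ▸ hx)) (fun h => hA.2 (h ▸ hx))
      (A.2.2.mem_branch (not_not.2 hx) hA.1 hA.2)
  have hand (A : NCstar X) (hAo : o ∈ A.1) (hAe : e ∈ A.1) : (A.1 : Set X) = univ := by
    by_contra hne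
    obtain ⟨x, hx⟩ := (ne_univ_iff_exists_notMem _).1 hne
    exact hbtw (x := x) (fun h => hx (h ▸ hAo)) (fun h => hx (h ▸ hAe))
      (A.2.1.isPreconnected.mem_branch hx hAo hAe)
  -- the elements of NC*(X) containing a given end point form a chain
  have hchain {o e : X} (hbtw : ∀ {x : X}, x ≠ o → x ≠ e → e ∉ branch x o)
      (hand : ∀ A : NCstar X, o ∈ A.1 → e ∈ A.1 → (A.1 : Set X) = univ)
      (A B : NCstar X) (hA : o ∈ A.1) (hB : o ∈ B.1) : A.1 ≤ B.1 ∨ B.1 ≤ A.1 := by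
    by_contra! hAB
    obtain ⟨x, hxA, hxB⟩ := not_subset.1 hAB.1
    obtain ⟨y, hyB, hyA⟩ := not_subset.1 hAB.2
    have hxo : x ≠ o := fun h => hxB (h ▸ hB)
    have hyo : y ≠ o := fun h => hyA (h ▸ hA)
    have hxe : x ≠ e := by
      rintro rfl
      exact hyA (hand A hA hxA ▸ mem_univ y)
    have hye : y ≠ e := by
      rintro rfl
      exact hxB (hand B hB hyB ▸ mem_univ x)
    have hyx : y ∈ branch x o := B.2.1.isPreconnected.mem_branch hxB hB hyB
    have hxy : x ∈ branch y o := A.2.1.isPreconnected.mem_branch hyA hA hxA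
    have hsub : (branch x o)ᶜ ⊆ branch y o :=
      (isConnected_compl_branch x o).isPreconnected.subset_branch (not_not.2 hyx)
        (self_notMem_branch x o) hxy
    exact hbtw hyo hye (hsub (hbtw hxo hxe))
  obtain ⟨w, hw, hwanti⟩ := exists_continuous_strictAnti_nonemptyCompacts (X := X)
  have hinj {o e : X} (hbtw : ∀ {x : X}, x ≠ o → x ≠ e → e ∉ branch x o)
      (hand : ∀ A : NCstar X, o ∈ A.1 → e ∈ A.1 → (A.1 : Set X) = univ)
      (A B : NCstar X) (hA : o ∈ A.1) (hB : o ∈ B.1) (hAB : w A.1 = w B.1) : A = B := by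
    apply Subtype.ext
    by_contra hne
    rcases hchain hbtw hand A B hA hB with h | h
    · exact (hwanti (h.lt_of_ne hne)).ne' hAB
    · exact (hwanti (h.lt_of_ne (Ne.symm hne))).ne hAB
  let top : NCstar X := NCstar.mk univ isClosed_univ isConnected_univ
    (by rw [compl_univ]; exact isPreconnected_empty)
  have htop_le (A : NCstar X) : w top.1 ≤ w A.1 := hwanti.antitone (subset_univ _)
  have htop (A : NCstar X) (hAo : o ∈ A.1) (hAe : e ∈ A.1) : A = top :=
    Subtype.ext (SetLike.coe_injective (hand A hAo hAe))
  have htop_eq (A : NCstar X) (hA : w A.1 = w top.1) : A = top := by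
    rcases hor A with h | h
    · exact hinj hbtw hand A top h (mem_univ o) hA
    · exact hinj (fun hx hx' h => hbtw hx' hx (mem_branch_symm h))
        (fun A h h' => hand A h' h) A top h (mem_univ e) hA
  classical
  let f (A : NCstar X) : ℝ := if o ∈ A.1 then w A.1 - w top.1 else w top.1 - w A.1
  have hclosed (x : X) : IsClosed {A : NCstar X | x ∈ A.1} := by
    have := (NonemptyCompacts.isClosed_inter_nonempty_of_isClosed
      (isClosed_singleton (x := x))).preimage (continuous_coe_NCstar (X := X))
    simpa [inter_singleton_nonempty] using this
  have hwc : Continuous fun A : NCstar X => w A.1 := hw.comp continuous_coe_NCstar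
  have hf : Continuous f := by
    rw [← continuousOn_univ, ← eq_univ_of_forall (s := {A : NCstar X | o ∈ A.1} ∪ {A | e ∈ A.1}) hor]
    refine ContinuousOn.union_of_isClosed ?_ ?_ (hclosed o) (hclosed e)
    · exact (hwc.sub (continuous_const (y := w top.1))).continuousOn.congr fun A hA => if_pos hA
    · refine ((continuous_const (y := w top.1)).sub hwc).continuousOn.congr fun A hA => ?_
      by_cases hAo : o ∈ A.1
      · simp [f, htop A hAo hA]
      · exact if_neg hAo
  have hfinj : Function.Injective f := by
    intro A B hAB
    have h1 := htop_le A
    have h2 := htop_le B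
    simp only [f] at hAB
    split_ifs at hAB with hA hB hB
    · exact hinj hbtw hand A B hA hB (by linarith)
    · rw [htop_eq A (by linarith), htop_eq B (by linarith)]
    · rw [htop_eq A (by linarith), htop_eq B (by linarith)]
    · exact hinj (fun hx hx' h => hbtw hx' hx (mem_branch_symm h))
        (fun A h h' => hand A h' h) A B ((hor A).resolve_left hA) ((hor B).resolve_left hB)
        (by linarith)
  exact nonempty_homeomorph_unitInterval_of_injective (hf.comp h.continuous)
    (hfinj.comp h.injective)
end

section
/- Let G be a finite graph (a continuum which is a finite union of arcs, any two of which meet in a finite set) that is a tangle (has no cut-points), and let p ∈ G and A ∈ NC*(G) with p ∉ A. Then there is a path α : [0,1] → NC*(G) (continuous in the Hausdorff metric) with α(0) = A, α(1) = G, and p ∉ α(t) for every t ∈ [0,1). -/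
open TopologicalSpace Set

/-- A finite graph: a space which is a finite union of arcs, any two of which meet
in a finite set. -/
def IsFiniteGraph (G : Type*) [TopologicalSpace G] : Prop :=
  ∃ 𝒜 : Finset (Set G),
    (⋃ A ∈ 𝒜, A) = Set.univ ∧
    (∀ A ∈ 𝒜, Nonempty (unitInterval ≃ₜ A)) ∧
    (∀ A ∈ 𝒜, ∀ B ∈ 𝒜, A ≠ B → (A ∩ B).Finite)

universe u

/-- A finite set of vertices is cut-connected for `adj` if its only nonempty subset closed under
adjacency is the whole set. -/
def CutConnected {α : Type*} (adj : α → α → Prop) (T : Finset α) : Prop :=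
  ∀ X ⊆ T, X.Nonempty → (∀ x ∈ X, ∀ y ∈ T, adj x y → y ∈ X) → X = T

section Combinatorics

variable {α : Type*} [DecidableEq α] {adj : α → α → Prop}

/-- If `T` is not cut-connected then some proper part of `T` avoiding a given vertex is closed under
adjacency. -/
theorem exists_closed_part_of_not_cutConnected (hs : ∀ x y, adj x y → adj y x) {T : Finset α}
    (hT : ¬ CutConnected adj T) (p : α) :
    ∃ C ⊆ T, C.Nonempty ∧ p ∉ C ∧ ∀ x ∈ C, ∀ y ∈ T, adj x y → y ∈ C := by
  unfold CutConnected at hT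
  push Not at hT
  obtain ⟨X, hXT, hXne, hX, hne⟩ := hT
  by_cases hpX : p ∈ X
  · refine ⟨T \ X, Finset.sdiff_subset, ?_, by simp [hpX], ?_⟩
    · rw [Finset.sdiff_nonempty]
      exact fun h => hne (hXT.antisymm h)
    · intro x hx y hy hxy
      rw [Finset.mem_sdiff] at hx ⊢
      exact ⟨hy, fun hyX => hx.2 (hX y hyX x hx.1 (hs _ _ hxy))⟩
  · exact ⟨X, hXT, hXne, hpX, hX⟩

theorem exists_removable_vertex_of_part (hs : ∀ x y, adj x y → adj y x) {V T : Finset α} {p s : α}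
    (hTV : T ⊆ V) (hp : p ∈ T) (hsV : s ∈ V) (hsT : s ∉ T)
    (hV : ∀ v ∈ V, CutConnected adj (V.erase v)) (hT : CutConnected adj T) (n : ℕ) :
    ∀ (v : α) (C : Finset α), C.card = n → v ∈ T → C ⊆ T.erase v → C.Nonempty → p ∉ C →
      (∀ x ∈ C, ∀ y ∈ T.erase v, adj x y → y ∈ C) →
      ∃ w ∈ T, w ≠ p ∧ (∃ u ∈ V \ T, adj w u) ∧ CutConnected adj (T.erase w) := by
  induction n using Nat.strong_induction_on with
  | _ n ih =>
  intro v C hn hv hC hCne hpC hCcl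
  obtain ⟨w, hwC, u, hu, hwu⟩ : ∃ w ∈ C, ∃ u ∈ V \ T, adj w u := by
    by_contra! hcon
    have h := hV v (hTV hv) C (hC.trans (Finset.erase_subset_erase _ hTV)) hCne (by
      intro x hx y hy hxy
      by_cases hyT : y ∈ T
      · exact hCcl x hx y (Finset.mem_erase.2 ⟨(Finset.mem_erase.1 hy).1, hyT⟩) hxy
      · exact (hcon x hx y (Finset.mem_sdiff.2 ⟨(Finset.mem_erase.1 hy).2, hyT⟩) hxy).elim)
    have hsC : s ∈ C := by
      rw [h]
      exact Finset.mem_erase.2 ⟨fun e => hsT (e ▸ hv), hsV⟩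
    exact hsT (Finset.mem_of_mem_erase (hC hsC))
  have hwT : w ∈ T := Finset.mem_of_mem_erase (hC hwC)
  have hwp : w ≠ p := fun e => hpC (e ▸ hwC)
  by_cases hgood : CutConnected adj (T.erase w)
  · exact ⟨w, hwT, hwp, ⟨u, hu, hwu⟩, hgood⟩
  obtain ⟨D, hD, hDne, hpD, hDcl⟩ := exists_closed_part_of_not_cutConnected hs hgood p
  have hvC : v ∉ C := fun h => (Finset.mem_erase.1 (hC h)).1 rfl
  have hrest : CutConnected adj (T \ C) := by
    by_contra hcon
    obtain ⟨X, hX, hXne, hvX, hXcl⟩ := exists_closed_part_of_not_cutConnected hs hcon v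
    have hXT := hT X (hX.trans Finset.sdiff_subset) hXne (by
      intro x hx y hy hxy
      have hxTC := Finset.mem_sdiff.1 (hX hx)
      refine hXcl x hx y (Finset.mem_sdiff.2 ⟨hy, fun hyC => hxTC.2 ?_⟩) hxy
      exact hCcl y hyC x (Finset.mem_erase.2 ⟨fun e => hvX (e ▸ hx), hxTC.1⟩) (hs _ _ hxy))
    exact hvX (hXT ▸ hv)
  have hDC : D ⊆ C := by
    intro d hd
    by_contra hdC
    have h := hrest (D \ C) ?_ ⟨d, Finset.mem_sdiff.2 ⟨hd, hdC⟩⟩ ?_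
    · have : p ∈ D \ C := h ▸ Finset.mem_sdiff.2 ⟨hp, hpC⟩
      exact hpD (Finset.mem_sdiff.1 this).1
    · exact Finset.sdiff_subset_sdiff (hD.trans (Finset.erase_subset _ _)) subset_rfl
    · intro x hx y hy hxy
      rw [Finset.mem_sdiff] at hx hy ⊢
      exact ⟨hDcl x hx.1 y (Finset.mem_erase.2 ⟨fun e => hy.2 (e ▸ hwC), hy.1⟩) hxy, hy.2⟩
  have hcard : D.card < n := by
    rw [← hn]
    refine Finset.card_lt_card (Finset.ssubset_iff_subset_ne.2 ⟨hDC, fun e => ?_⟩)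
    exact (Finset.mem_erase.1 (hD (e ▸ hwC))).1 rfl
  exact ih _ hcard w D rfl hwT hD hDne hpD hDcl

/-- The existence of `st`-numberings: in a finite graph without cut vertices, the connected set `T`
can be numbered so that each vertex of `T` has a lower neighbour, and each vertex of `T` other
than `p` has a higher one. -/
theorem exists_st_numbering (hs : ∀ x y, adj x y → adj y x) {V : Finset α} {p s : α}
    (hsV : s ∈ V) (hV : ∀ v ∈ V, CutConnected adj (V.erase v)) (n : ℕ) :
    ∀ T : Finset α, T.card = n → T ⊆ V → p ∈ T → s ∉ T → CutConnected adj T →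
      (∃ u ∈ V \ T, ∃ v ∈ T, adj v u) →
      ∃ g : α → ℕ, (∀ x, g x = 0 ↔ x ∉ T) ∧ InjOn g T ∧ (∀ x, g x ≤ g p) ∧
        (∀ x ∈ T, ∃ y ∈ V, adj x y ∧ g y < g x) ∧
        (∀ x ∈ T, x ≠ p → ∃ y ∈ V, adj x y ∧ g x < g y) := by
  induction n with
  | zero =>
    intro T h0 _ hp
    rw [Finset.card_eq_zero] at h0
    simp [h0] at hp
  | succ n ih =>
  intro T hn hTV hp hsT hT hadj
  rcases eq_or_ne (T.erase p) ∅ with hTp | hTp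
  · have hTp' : ∀ x ∈ T, x = p := by
      intro x hx
      by_contra hne
      have : x ∈ T.erase p := Finset.mem_erase.2 ⟨hne, hx⟩
      simp [hTp] at this
    obtain ⟨u, hu, v, hv, hvu⟩ := hadj
    refine ⟨fun x => if x ∈ T then 1 else 0, by simp, ?_, ?_, ?_, ?_⟩
    · intro x hx y hy _
      rw [hTp' x hx, hTp' y hy]
    · intro x
      simp only [hp, if_true]
      split_ifs <;> simp
    · intro x hx
      obtain rfl : x = v := (hTp' x hx).trans (hTp' v hv).symm
      rw [Finset.mem_sdiff] at hu
      exact ⟨u, hu.1, hvu, by simp [hx, hu.2]⟩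
    · intro x hx hne
      exact (hne (hTp' x hx)).elim
  · obtain ⟨w, hwT, hwp, ⟨u, hu, hwu⟩, hgood⟩ :=
      exists_removable_vertex_of_part hs hTV hp hsV hsT hV hT _ p (T.erase p) rfl hp subset_rfl
        (Finset.nonempty_iff_ne_empty.2 hTp) (by simp) (fun x _ y hy _ => hy)
    have hup : ∃ y ∈ T.erase w, adj w y := by
      by_contra! hcon
      have h := hT {w} (by simpa using hwT) (by simp) (by
        intro x hx y hy hxy
        obtain rfl := Finset.mem_singleton.1 hx
        by_contra hyw
        exact hcon y (Finset.mem_erase.2 ⟨by simpa using hyw, hy⟩) hxy)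
      rw [← h, Finset.mem_singleton] at hp
      exact hwp hp.symm
    obtain ⟨y, hy, hwy⟩ := hup
    have hyT := Finset.mem_of_mem_erase hy
    obtain ⟨g, hg0, hginj, hgp, hlow, hhigh⟩ := ih (T.erase w)
      (by rw [Finset.card_erase_of_mem hwT, hn]; rfl) ((Finset.erase_subset _ _).trans hTV)
      (Finset.mem_erase.2 ⟨hwp.symm, hp⟩) (fun h => hsT (Finset.mem_of_mem_erase h)) hgood
      ⟨w, by simp [hTV hwT], y, hy, hs _ _ hwy⟩
    have hgw : g w = 0 := by simp [hg0]
    have hpos : ∀ x ∈ T, x ≠ w → 0 < g x := fun x hx hxw =>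
      Nat.pos_of_ne_zero fun h => (hg0 x).1 h (Finset.mem_erase.2 ⟨hxw, hx⟩)
    refine ⟨fun x => if x ∈ T then g x + 1 else 0, by simp, ?_, ?_, ?_, ?_⟩
    · intro a ha b hb hab
      rw [Finset.mem_coe] at ha hb
      simp only [ha, hb, if_true, add_left_inj] at hab
      by_cases haw : a = w <;> by_cases hbw : b = w
      · rw [haw, hbw]
      · have := hpos b hb hbw
        subst haw
        omega
      · have := hpos a ha haw
        subst hbw
        omega
      · exact hginj (by simp [ha, haw]) (by simp [hb, hbw]) hab
    · intro x
      have := hgp x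
      simp only [hp, if_true]
      split_ifs <;> omega
    · intro x hx
      by_cases hxw : x = w
      · subst hxw
        rw [Finset.mem_sdiff] at hu
        exact ⟨u, hu.1, hwu, by simp [hu.2, hx]⟩
      · obtain ⟨z, hz, hxz, hlt⟩ := hlow x (Finset.mem_erase.2 ⟨hxw, hx⟩)
        refine ⟨z, hz, hxz, ?_⟩
        simp only [hx, if_true]
        split_ifs <;> omega
    · intro x hx hxp
      by_cases hxw : x = w
      · subst hxw
        refine ⟨y, hTV hyT, hwy, ?_⟩
        have := hpos y hyT (Finset.mem_erase.1 hy).1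
        simp only [hx, hyT, if_true]
        omega
      · obtain ⟨z, hz, hxz, hlt⟩ := hhigh x (Finset.mem_erase.2 ⟨hxw, hx⟩) hxp
        have hzT : z ∈ T := by
          by_contra hzT
          have : g z = 0 := (hg0 z).2 fun h => hzT (Finset.mem_of_mem_erase h)
          omega
        refine ⟨z, hz, hxz, ?_⟩
        simp only [hx, hzT, if_true]
        omega

end Combinatorics

/-- A decomposition of a space into a finite set `V` of vertices and finitely many edges: arcs with
end points in `V` whose interiors are pairwise disjoint and disjoint from `V`. -/
structure EdgeDecomposition {G : Type u} [TopologicalSpace G] (V : Finset G) where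
  /-- The index type of the edges. -/
  ι : Type u
  finite : Finite ι
  /-- The parametrization of each edge by the unit interval. -/
  γ : ι → ℝ → G
  continuous : ∀ i, Continuous (γ i)
  injOn : ∀ i, InjOn (γ i) (Icc 0 1)
  zero_mem : ∀ i, γ i 0 ∈ V
  one_mem : ∀ i, γ i 1 ∈ V
  notMem : ∀ i, ∀ t ∈ Ioo (0 : ℝ) 1, γ i t ∉ V
  eq_of_eq : ∀ i j, ∀ t ∈ Ioo (0 : ℝ) 1, ∀ s ∈ Ioo (0 : ℝ) 1, γ i t = γ j s → i = j
  cover : ∀ x, x ∈ V ∨ ∃ i, ∃ t ∈ Ioo (0 : ℝ) 1, γ i t = x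

/-- For a finite graph, all sufficiently large finite sets are vertex sets of edge
decompositions. -/
theorem IsFiniteGraph.exists_edgeDecomposition {G : Type u} [TopologicalSpace G]
    (hG : IsFiniteGraph G) :
    ∃ V₀ : Finset G, ∀ V : Finset G, V₀ ⊆ V → Nonempty (EdgeDecomposition V) := by
  classical
  obtain ⟨𝒜, hcov, harc, hfin⟩ := hG
  have φ : ∀ A : 𝒜, unitInterval ≃ₜ A.1 := fun A => (harc A.1 A.2).some
  let c : 𝒜 → ℝ → G := fun A s => (φ A (projIcc 0 1 zero_le_one s) : G)
  have hc : ∀ A, Continuous (c A) := fun A =>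
    continuous_subtype_val.comp ((φ A).continuous.comp continuous_projIcc)
  have hcinj : ∀ A, InjOn (c A) (Icc 0 1) := by
    intro A s hs t ht hst
    have h := (φ A).injective (Subtype.ext hst)
    rw [projIcc_of_mem _ hs, projIcc_of_mem _ ht] at h
    exact congrArg Subtype.val h
  have hcmem : ∀ A s, c A s ∈ A.1 := fun A s => (φ A _).2
  have hcsurj : ∀ A : 𝒜, ∀ x ∈ A.1, ∃ s ∈ Icc (0 : ℝ) 1, c A s = x := by
    intro A x hx
    refine ⟨(φ A).symm ⟨x, hx⟩, Subtype.prop _, ?_⟩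
    simp [c]
  have hW : ((⋃ A : 𝒜, ⋃ B : 𝒜, {x | A ≠ B ∧ x ∈ A.1 ∩ B.1}) ∪
      (range (fun A => c A 0) ∪ range (fun A => c A 1))).Finite := by
    refine (finite_iUnion fun A => finite_iUnion fun B => ?_).union
      ((finite_range _).union (finite_range _))
    by_cases h : A = B
    · simp [h]
    · exact (hfin A.1 A.2 B.1 B.2 fun e => h (Subtype.ext e)).subset fun x hx => hx.2
  refine ⟨hW.toFinset, fun V hV => ?_⟩
  have hV0 : ∀ A, c A 0 ∈ V := fun A => hV (by simp)
  have hV1 : ∀ A, c A 1 ∈ V := fun A => hV (by simp)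
  have hVeq : ∀ A B : 𝒜, ∀ x, x ∉ V → x ∈ A.1 → x ∈ B.1 → A = B := by
    intro A B x hx hA hB
    by_contra hne
    refine hx (hV (hW.mem_toFinset.2 (Or.inl ?_)))
    simp only [mem_iUnion]
    exact ⟨A, B, hne, hA, hB⟩
  let F : 𝒜 → Set ℝ := fun A => {s | s ∈ Icc (0 : ℝ) 1 ∧ c A s ∈ V}
  have hF : ∀ A, (F A).Finite := fun A =>
    Finite.of_injOn (fun s hs => hs.2) ((hcinj A).mono fun s hs => hs.1) V.finite_toSet
  let gaps : Set (𝒜 × ℝ × ℝ) := {x | x.2.1 ∈ F x.1 ∧ x.2.2 ∈ F x.1 ∧ x.2.1 < x.2.2 ∧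
    ∀ s ∈ Ioo x.2.1 x.2.2, c x.1 s ∉ V}
  have hgaps : gaps.Finite := by
    refine (finite_iUnion fun A => (finite_singleton A).prod ((hF A).prod (hF A))).subset ?_
    rintro ⟨A, a, b⟩ h
    exact mem_iUnion.2 ⟨A, rfl, h.1, h.2.1⟩
  have haff : ∀ x : gaps, ∀ t ∈ Ioo (0 : ℝ) 1,
      x.1.2.1 + t * (x.1.2.2 - x.1.2.1) ∈ Ioo x.1.2.1 x.1.2.2 := by
    rintro ⟨⟨A, a, b⟩, -, -, hab, -⟩ t ⟨ht0, ht1⟩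
    simp only at hab ⊢
    constructor <;> nlinarith
  have haff' : ∀ x : gaps, ∀ t ∈ Icc (0 : ℝ) 1,
      x.1.2.1 + t * (x.1.2.2 - x.1.2.1) ∈ Icc (0 : ℝ) 1 := by
    rintro ⟨⟨A, a, b⟩, ha, hb, hab, -⟩ t ⟨ht0, ht1⟩
    have h0 := ha.1.1
    have h1 := hb.1.2
    simp only at hab h0 h1 ⊢
    constructor <;> nlinarith
  exact ⟨{
    ι := gaps
    finite := hgaps.to_subtype
    γ := fun x t => c x.1.1 (x.1.2.1 + t * (x.1.2.2 - x.1.2.1))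
    continuous := fun x => (hc _).comp (by fun_prop)
    injOn := by
      intro x s hs t ht hst
      have h := hcinj _ (haff' x s hs) (haff' x t ht) hst
      have hlt := x.2.2.2.1
      exact mul_right_cancel₀ (sub_pos.2 hlt).ne' (add_left_cancel h)
    zero_mem := fun x => by simpa using x.2.1.2
    one_mem := fun x => by simpa using x.2.2.1.2
    notMem := fun x t ht => x.2.2.2.2 _ (haff x t ht)
    eq_of_eq := by
      intro x y t ht s hs hts
      have hx := haff x t ht
      have hy := haff y s hs
      have hx' := haff' x t (Ioo_subset_Icc_self ht)
      have hy' := haff' y s (Ioo_subset_Icc_self hs)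
      have hnx := x.2.2.2.2 _ hx
      obtain ⟨⟨A, a, b⟩, ha, hb, hab, hgap⟩ := x
      obtain ⟨⟨B, a', b'⟩, ha', hb', hab', hgap'⟩ := y
      simp only at *
      obtain rfl : A = B := hVeq A B _ hnx (hcmem _ _) (hts ▸ hcmem _ _)
      have he := hcinj _ hx' hy' hts
      rw [← he] at hy
      generalize a + t * (b - a) = r at *
      have h1 : ∀ u ∈ F A, ¬ (a < u ∧ u < b) := fun u hu h => hgap u h hu.2
      have h2 : ∀ u ∈ F A, ¬ (a' < u ∧ u < b') := fun u hu h => hgap' u h hu.2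
      have e1 : a = a' := by
        have := h1 a' ha'
        have := h2 a ha
        have := hx.1
        have := hx.2
        have := hy.1
        have := hy.2
        grind
      have e2 : b = b' := by
        have := h1 b' hb'
        have := h2 b hb
        have := hx.1
        have := hx.2
        have := hy.1
        have := hy.2
        grind
      subst e1 e2
      rfl
    cover := by
      intro x
      by_cases hxV : x ∈ V
      · exact Or.inl hxV
      right
      have hx : x ∈ ⋃ A ∈ 𝒜, A := hcov ▸ mem_univ x
      obtain ⟨A, hA, hxA⟩ := mem_iUnion₂.1 hx
      obtain ⟨s, hs, hsx⟩ := hcsurj ⟨A, hA⟩ x hxA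
      generalize (⟨A, hA⟩ : 𝒜) = B at hsx
      have hs0 : 0 < s := lt_of_le_of_ne hs.1 fun e => hxV (by rw [← hsx, ← e]; exact hV0 B)
      have hs1 : s < 1 := lt_of_le_of_ne hs.2 fun e => hxV (by rw [← hsx, e]; exact hV1 B)
      obtain ⟨a, ⟨haF, has⟩, hamax⟩ := exists_max_image (F B ∩ Iio s) id
        ((hF B).subset inter_subset_left) ⟨0, ⟨⟨le_rfl, zero_le_one⟩, hV0 B⟩, hs0⟩
      obtain ⟨b, ⟨hbF, hbs⟩, hbmin⟩ := exists_min_image (F B ∩ Ioi s) id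
        ((hF B).subset inter_subset_left) ⟨1, ⟨⟨zero_le_one, le_rfl⟩, hV1 B⟩, hs1⟩
      simp only [mem_Iio, mem_Ioi, id] at has hbs hamax hbmin
      have hab : 0 < b - a := by linarith
      refine ⟨⟨(B, a, b), haF, hbF, by simp only; linarith, ?_⟩, (s - a) / (b - a), ⟨?_, ?_⟩, ?_⟩
      · rintro u ⟨hua, hub⟩ huV
        simp only at hua hub huV
        have huF : u ∈ F B := ⟨⟨haF.1.1.trans hua.le, hub.le.trans hbF.1.2⟩, huV⟩
        rcases lt_trichotomy u s with h | h | h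
        · exact absurd (hamax u ⟨huF, h⟩) (not_le.2 hua)
        · exact hxV (by rw [← hsx, ← h]; exact huV)
        · exact absurd (hbmin u ⟨huF, h⟩) (not_le.2 hub)
      · exact div_pos (by linarith) hab
      · rw [div_lt_one hab]
        linarith
      · simp only [div_mul_cancel₀ _ hab.ne', add_sub_cancel]
        exact hsx }⟩

namespace EdgeDecomposition

variable {G : Type u} [TopologicalSpace G] {V : Finset G} (D : EdgeDecomposition V)

/-- Two vertices are adjacent if they are the end points of an edge. -/
def Adj (u v : G) : Prop :=
  ∃ i, (D.γ i 0 = u ∧ D.γ i 1 = v) ∨ (D.γ i 0 = v ∧ D.γ i 1 = u)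

theorem adj_symm (u v : G) (h : D.Adj u v) : D.Adj v u := by
  obtain ⟨i, h⟩ := h
  exact ⟨i, h.symm⟩

theorem eq_zero_or_one {i : D.ι} {t : ℝ} (ht : t ∈ Icc (0 : ℝ) 1) (hV : D.γ i t ∈ V) :
    t = 0 ∨ t = 1 := by
  by_contra! h
  exact D.notMem i t ⟨lt_of_le_of_ne ht.1 h.1.symm, lt_of_le_of_ne ht.2 h.2⟩ hV

theorem mem_of_notMem_Ioo {i : D.ι} {t : ℝ} (ht : t ∈ Icc (0 : ℝ) 1) (h : t ∉ Ioo (0 : ℝ) 1) :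
    D.γ i t ∈ V := by
  have : t = 0 ∨ t = 1 := by
    by_contra! h'
    exact h ⟨lt_of_le_of_ne ht.1 h'.1.symm, lt_of_le_of_ne ht.2 h'.2⟩
  rcases this with rfl | rfl
  · exact D.zero_mem i
  · exact D.one_mem i

theorem index_eq {i j : D.ι} {t s : ℝ} (ht : t ∈ Ioo (0 : ℝ) 1) (hs : s ∈ Icc (0 : ℝ) 1)
    (h : D.γ i t = D.γ j s) : i = j := by
  refine D.eq_of_eq i j t ht s ?_ h
  by_contra hs'
  exact D.notMem i t ht (h ▸ D.mem_of_notMem_Ioo hs hs')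

theorem isClosed_image_Icc [T2Space G] (i : D.ι) (x z : ℝ) : IsClosed (D.γ i '' Icc x z) :=
  (isCompact_Icc.image (D.continuous i)).isClosed

theorem isOpen_image_Ioo [T2Space G] (i : D.ι) {x z : ℝ} (hx : 0 ≤ x) (hz : z ≤ 1) :
    IsOpen (D.γ i '' Ioo x z) := by
  have := D.finite
  have hcl : IsClosed ((V : Set G) ∪ (⋃ j : {j // j ≠ i}, D.γ j '' Icc 0 1) ∪
      (D.γ i '' Icc 0 x ∪ D.γ i '' Icc z 1)) :=
    (V.finite_toSet.isClosed.union (isClosed_iUnion_of_finite fun j =>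
      D.isClosed_image_Icc _ _ _)).union
      ((D.isClosed_image_Icc _ _ _).union (D.isClosed_image_Icc _ _ _))
  have hsub : Ioo x z ⊆ Ioo 0 1 := Ioo_subset_Ioo hx hz
  convert hcl.isOpen_compl using 1
  ext y
  simp only [mem_compl_iff, mem_union, not_or, mem_iUnion, not_exists]
  constructor
  · rintro ⟨t, ht, rfl⟩
    have ht' := Ioo_subset_Icc_self (hsub ht)
    refine ⟨⟨D.notMem i t (hsub ht), ?_⟩, ?_, ?_⟩
    · rintro ⟨j, hj⟩ ⟨s, hs, hst⟩
      exact hj (D.index_eq (hsub ht) hs hst.symm).symm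
    · rintro ⟨s, hs, hst⟩
      have h1 : s ≤ 1 := hs.2.trans (ht.1.le.trans ht'.2)
      have := D.injOn i ⟨hs.1, h1⟩ ht' hst
      linarith [hs.2, ht.1]
    · rintro ⟨s, hs, hst⟩
      have h1 : 0 ≤ s := ht'.1.trans (ht.2.le.trans hs.1)
      have := D.injOn i ⟨h1, hs.2⟩ ht' hst
      linarith [hs.1, ht.2]
  · rintro ⟨⟨hV, hj⟩, h0, h1⟩
    obtain ⟨j, t, ht, rfl⟩ := (D.cover y).resolve_left hV
    obtain rfl : j = i := by
      by_contra hne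
      exact hj ⟨j, hne⟩ ⟨t, Ioo_subset_Icc_self ht, rfl⟩
    refine ⟨t, ⟨?_, ?_⟩, rfl⟩ <;> by_contra! hlt
    · exact h0 ⟨t, ⟨ht.1.le, hlt⟩, rfl⟩
    · exact h1 ⟨t, ⟨hlt, ht.2.le⟩, rfl⟩

/-- If both end points of a subarc of an edge lie in a set with connected complement, and some
vertex does not, then the subarc is contained in the set. -/
theorem image_Icc_subset [T2Space G] {A : Set G} (hA : IsPreconnected Aᶜ) {p : G} (hpV : p ∈ V)
    (hpA : p ∉ A) (i : D.ι) {x z : ℝ} (hx : 0 ≤ x) (hz : z ≤ 1)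
    (hxA : D.γ i x ∈ A) (hzA : D.γ i z ∈ A) : D.γ i '' Icc x z ⊆ A := by
  rintro _ ⟨t, ht, rfl⟩
  by_contra htA
  obtain ⟨q, hqA, ⟨s, hs, rfl⟩, hq⟩ := isPreconnected_closed_iff.1 hA (D.γ i '' Icc x z)
    (D.γ i '' Ioo x z)ᶜ (D.isClosed_image_Icc i x z) (D.isOpen_image_Ioo i hx hz).isClosed_compl
    (by
      intro q _
      by_cases hq : q ∈ D.γ i '' Ioo x z
      · exact Or.inl (image_mono Ioo_subset_Icc_self hq)
      · exact Or.inr hq)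
    ⟨_, htA, t, ht, rfl⟩
    ⟨p, hpA, by
      rintro ⟨s, hs, rfl⟩
      exact D.notMem i s (Ioo_subset_Ioo hx hz hs) hpV⟩
  have hs' : s = x ∨ s = z := by
    by_contra! h
    exact hq ⟨s, ⟨lt_of_le_of_ne hs.1 h.1.symm, lt_of_le_of_ne hs.2 h.2⟩, rfl⟩
  rcases hs' with rfl | rfl
  · exact hqA hxA
  · exact hqA hzA

theorem finite_frontier [T2Space G] (D : EdgeDecomposition V) {A : Set G}
    (hAcl : IsClosed A) (hA : IsPreconnected Aᶜ)
    {p : G} (hpV : p ∈ V) (hpA : p ∉ A) : (frontier A).Finite := by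
  have := D.finite
  let S : D.ι → Set ℝ := fun i => {t | t ∈ Ioo (0 : ℝ) 1 ∧ D.γ i t ∈ frontier A}
  have hS : ∀ i, (S i).Finite := by
    intro i
    by_contra hinf
    obtain ⟨s, hsS, hs⟩ := Set.Infinite.exists_subset_card_eq hinf 3
    let e := s.orderEmbOfFin hs
    have he : ∀ k, e k ∈ S i := fun k => hsS (s.orderEmbOfFin_mem hs k)
    have h01 : e 0 < e 1 := e.strictMono (by decide)
    have h12 : e 1 < e 2 := e.strictMono (by decide)
    have hsub := D.image_Icc_subset hA hpV hpA i (he 0).1.1.le (he 2).1.2.le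
      (hAcl.frontier_subset (he 0).2) (hAcl.frontier_subset (he 2).2)
    have hint : D.γ i (e 1) ∈ interior A := by
      refine interior_maximal ((image_mono Ioo_subset_Icc_self).trans hsub)
        (D.isOpen_image_Ioo i (he 0).1.1.le (he 2).1.2.le) ⟨e 1, ⟨h01, h12⟩, rfl⟩
    exact (he 1).2.2 hint
  refine (V.finite_toSet.union (finite_iUnion fun i => (hS i).image (D.γ i))).subset ?_
  intro x hx
  rcases D.cover x with h | ⟨i, t, ht, rfl⟩
  · exact Or.inl h
  · exact Or.inr (mem_iUnion.2 ⟨i, t, ⟨ht, hx⟩, rfl⟩)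

/-- If no interior point of an edge is in the frontier of a closed set `A`, then the edge is
contained in `A` as soon as one of its interior points is. -/
theorem image_Icc_subset_of_frontier_subset {A : Set G} (hAcl : IsClosed A)
    (hV : frontier A ⊆ V) {i : D.ι} {t : ℝ} (ht : t ∈ Ioo (0 : ℝ) 1) (htA : D.γ i t ∈ A) :
    D.γ i '' Icc 0 1 ⊆ A := by
  have hsub : D.γ i '' Ioo 0 1 ⊆ A := by
    by_contra hne
    rw [not_subset] at hne
    obtain ⟨y, hy, hyA⟩ := hne
    have hpre : IsPreconnected (D.γ i '' Ioo 0 1) :=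
      isPreconnected_Ioo.image _ (D.continuous i).continuousOn
    have hfr : ∀ x ∈ D.γ i '' Ioo 0 1, x ∈ A → x ∈ interior A := by
      rintro _ ⟨s, hs, rfl⟩ hsA
      by_contra hn
      exact D.notMem i s hs (hV ⟨subset_closure hsA, hn⟩)
    obtain ⟨z, -, hz, hz'⟩ := hpre (interior A) Aᶜ isOpen_interior hAcl.isOpen_compl
      (fun x hx => (em (x ∈ A)).imp (hfr x hx) id)
      ⟨_, ⟨t, ht, rfl⟩, hfr _ ⟨t, ht, rfl⟩ htA⟩ ⟨y, hy, hyA⟩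
    exact hz' (interior_subset hz)
  rw [← closure_Ioo zero_ne_one]
  exact (image_closure_subset_closure_image (D.continuous i)).trans
    (hAcl.closure_subset_iff.2 hsub)

open Classical in
/-- A connected open part of the graph spans a connected set of vertices. -/
theorem cutConnected_filter [T2Space G] {K : Set G} (hK : IsPreconnected Kᶜ) :
    CutConnected D.Adj (V.filter (· ∉ K)) := by
  have := D.finite
  intro X hX hXne hXcl
  by_contra hne
  obtain ⟨y, hy, hyX⟩ : ∃ y ∈ V.filter (· ∉ K), y ∉ X := by
    by_contra! h
    exact hne (hX.antisymm h)
  obtain ⟨x, hx⟩ := hXne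
  let P : D.ι → Prop := fun i => D.γ i 0 ∈ X ∨ D.γ i 1 ∈ X
  have hXV : ∀ x ∈ X, x ∈ V ∧ x ∉ K := fun x hx => Finset.mem_filter.1 (hX hx)
  have hyV := Finset.mem_filter.1 hy
  obtain ⟨q, hqK, hq, hq'⟩ := isPreconnected_closed_iff.1 hK
    ((X : Set G) ∪ ⋃ i : {i // P i}, D.γ i '' Icc 0 1)
    (((V \ X : Finset G) : Set G) ∪ ⋃ i : {i // ¬ P i}, D.γ i '' Icc 0 1)
    (X.finite_toSet.isClosed.union (isClosed_iUnion_of_finite fun _ => D.isClosed_image_Icc _ _ _))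
    ((V \ X).finite_toSet.isClosed.union
      (isClosed_iUnion_of_finite fun _ => D.isClosed_image_Icc _ _ _))
    (by
      intro q _
      rcases D.cover q with h | ⟨i, t, ht, rfl⟩
      · by_cases hqX : q ∈ X
        · exact Or.inl (Or.inl hqX)
        · exact Or.inr (Or.inl (Finset.mem_coe.2 (Finset.mem_sdiff.2 ⟨h, hqX⟩)))
      · by_cases hi : P i
        · exact Or.inl (Or.inr (mem_iUnion.2 ⟨⟨i, hi⟩, t, Ioo_subset_Icc_self ht, rfl⟩))
        · exact Or.inr (Or.inr (mem_iUnion.2 ⟨⟨i, hi⟩, t, Ioo_subset_Icc_self ht, rfl⟩)))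
    ⟨x, (hXV x hx).2, Or.inl hx⟩
    ⟨y, hyV.2, Or.inl (Finset.mem_coe.2 (Finset.mem_sdiff.2 ⟨hyV.1, hyX⟩))⟩
  have hqX : q ∈ V → q ∈ X := by
    intro hqV
    rcases hq with h | h
    · exact h
    obtain ⟨⟨i, hi⟩, t, ht, rfl⟩ := mem_iUnion.1 h
    have hmem := Finset.mem_filter.2 ⟨hqV, hqK⟩
    rcases D.eq_zero_or_one ht hqV with rfl | rfl <;> rcases hi with hi | hi
    · exact hi
    · exact hXcl _ hi _ hmem ⟨i, Or.inr ⟨rfl, rfl⟩⟩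
    · exact hXcl _ hi _ hmem ⟨i, Or.inl ⟨rfl, rfl⟩⟩
    · exact hi
  have hqV : q ∉ V := by
    intro hqV
    rcases hq' with h | h
    · exact (Finset.mem_sdiff.1 (Finset.mem_coe.1 h)).2 (hqX hqV)
    obtain ⟨⟨i, hi⟩, t, ht, rfl⟩ := mem_iUnion.1 h
    rcases D.eq_zero_or_one ht hqV with rfl | rfl
    · exact hi (Or.inl (hqX hqV))
    · exact hi (Or.inr (hqX hqV))
  rcases hq with h | h
  · exact hqV (hXV q h).1
  rcases hq' with h' | h'
  · exact hqV (Finset.mem_sdiff.1 (Finset.mem_coe.1 h')).1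
  obtain ⟨⟨i, hi⟩, t, ht, rfl⟩ := mem_iUnion.1 h
  obtain ⟨⟨j, hj⟩, s, hs, hst⟩ := mem_iUnion.1 h'
  have ht' : t ∈ Ioo (0 : ℝ) 1 := by
    by_contra hn
    exact hqV (D.mem_of_notMem_Ioo ht hn)
  obtain rfl : i = j := D.index_eq ht' hs hst.symm
  exact hj hi

open Classical in
/-- The extension of a function on the vertices which is affine along each edge. -/
noncomputable def extend (f : G → ℝ) (x : G) : ℝ :=
  if h : ∃ a : D.ι × ℝ, a.2 ∈ Ioo (0 : ℝ) 1 ∧ D.γ a.1 a.2 = x then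
    (1 - h.choose.2) * f (D.γ h.choose.1 0) + h.choose.2 * f (D.γ h.choose.1 1)
  else f x

theorem extend_of_mem (f : G → ℝ) {x : G} (hx : x ∈ V) : D.extend f x = f x := by
  refine dif_neg ?_
  rintro ⟨a, ha, rfl⟩
  exact D.notMem _ _ ha hx

theorem extend_apply (f : G → ℝ) (i : D.ι) {t : ℝ} (ht : t ∈ Icc (0 : ℝ) 1) :
    D.extend f (D.γ i t) = (1 - t) * f (D.γ i 0) + t * f (D.γ i 1) := by
  by_cases ht' : t ∈ Ioo (0 : ℝ) 1
  · have h : ∃ a : D.ι × ℝ, a.2 ∈ Ioo (0 : ℝ) 1 ∧ D.γ a.1 a.2 = D.γ i t := ⟨(i, t), ht', rfl⟩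
    have hspec := h.choose_spec
    rw [extend, dif_pos h]
    generalize h.choose = a at hspec
    obtain ⟨j, s⟩ := a
    obtain rfl : j = i := D.index_eq hspec.1 ht hspec.2
    obtain rfl : s = t := D.injOn j (Ioo_subset_Icc_self hspec.1) ht hspec.2
    rfl
  · have hV := D.mem_of_notMem_Ioo (i := i) ht ht'
    rw [D.extend_of_mem f hV]
    rcases D.eq_zero_or_one ht hV with rfl | rfl <;> simp

theorem extend_neg (f : G → ℝ) (x : G) : D.extend (fun y => -f y) x = -D.extend f x := by
  rcases D.cover x with h | ⟨i, t, ht, rfl⟩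
  · rw [D.extend_of_mem _ h, D.extend_of_mem _ h]
  · rw [D.extend_apply _ i (Ioo_subset_Icc_self ht), D.extend_apply _ i (Ioo_subset_Icc_self ht)]
    ring

theorem continuous_extend [T2Space G] (f : G → ℝ) : Continuous (D.extend f) := by
  have := D.finite
  rw [continuous_iff_isClosed]
  intro C hC
  have hpre : D.extend f ⁻¹' C = ((V : Set G) ∩ D.extend f ⁻¹' C) ∪ ⋃ i, D.γ i ''
      (Icc 0 1 ∩ (fun t : ℝ => (1 - t) * f (D.γ i 0) + t * f (D.γ i 1)) ⁻¹' C) := by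
    ext x
    simp only [mem_union, mem_inter_iff, mem_iUnion, mem_preimage, Finset.mem_coe]
    constructor
    · intro hx
      rcases D.cover x with h | ⟨i, t, ht, rfl⟩
      · exact Or.inl ⟨h, hx⟩
      · have ht' := Ioo_subset_Icc_self ht
        rw [D.extend_apply f i ht'] at hx
        exact Or.inr ⟨i, t, ⟨ht', hx⟩, rfl⟩
    · rintro (h | ⟨i, t, ⟨ht, hx⟩, rfl⟩)
      · exact h.2
      · rw [D.extend_apply f i ht]
        exact hx
  rw [hpre]
  refine (V.finite_toSet.subset inter_subset_left).isClosed.union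
    (isClosed_iUnion_of_finite fun i => ?_)
  refine ((isCompact_Icc.inter_right (hC.preimage ?_)).image (D.continuous i)).isClosed
  fun_prop

/-- Along an edge, the affine extension is strictly monotone. -/
theorem extend_lt_of_mem_uIcc (f : G → ℝ) (i : D.ι) {s t : ℝ} (hs : s ∈ Icc (0 : ℝ) 1)
    (ht : t ∈ Icc (0 : ℝ) 1) (hst : D.extend f (D.γ i s) < D.extend f (D.γ i t)) :
    ∀ z ∈ D.γ i '' uIcc s t, z ≠ D.γ i t → D.extend f z < D.extend f (D.γ i t) := by
  rintro _ ⟨r, hr, rfl⟩ hne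
  have hrt : r ≠ t := fun e => hne (e ▸ rfl)
  have hr' : r ∈ Icc (0 : ℝ) 1 := uIcc_subset_Icc hs ht hr
  rw [D.extend_apply f i hs, D.extend_apply f i ht] at hst
  rw [D.extend_apply f i hr', D.extend_apply f i ht]
  rcases le_total s t with h | h
  · rw [uIcc_of_le h] at hr
    have hlt : r < t := lt_of_le_of_ne hr.2 hrt
    have : 0 < f (D.γ i 1) - f (D.γ i 0) := by
      by_contra! hn
      nlinarith
    nlinarith
  · rw [uIcc_of_ge h] at hr
    have hlt : t < r := lt_of_le_of_ne hr.1 hrt.symm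
    have : f (D.γ i 1) - f (D.γ i 0) < 0 := by
      by_contra! hn
      nlinarith
    nlinarith

/-- From a point which is not a local minimum on the vertices or along the edges, there is a
descending arc to a vertex. -/
theorem exists_descent (f : G → ℝ) (x : G) (hv : x ∈ V → ∃ y ∈ V, D.Adj x y ∧ f y < f x)
    (he : ∀ i, ∀ t ∈ Ioo (0 : ℝ) 1, D.γ i t = x → f (D.γ i 0) ≠ f (D.γ i 1)) :
    ∃ y ∈ V, D.extend f y < D.extend f x ∧ ∃ C, IsPreconnected C ∧ x ∈ C ∧ y ∈ C ∧
      ∀ z ∈ C, z ≠ x → D.extend f z < D.extend f x := by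
  suffices ∃ i, ∃ s ∈ Icc (0 : ℝ) 1, ∃ t ∈ Icc (0 : ℝ) 1, D.γ i s ∈ V ∧ D.γ i t = x ∧
      D.extend f (D.γ i s) < D.extend f (D.γ i t) by
    obtain ⟨i, s, hs, t, ht, hsV, rfl, hst⟩ := this
    exact ⟨_, hsV, hst, D.γ i '' uIcc s t, isPreconnected_uIcc.image _ (D.continuous i).continuousOn,
      ⟨t, right_mem_uIcc, rfl⟩, ⟨s, left_mem_uIcc, rfl⟩, D.extend_lt_of_mem_uIcc f i hs ht hst⟩
  have h0 : (0 : ℝ) ∈ Icc (0 : ℝ) 1 := ⟨le_rfl, zero_le_one⟩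
  have h1 : (1 : ℝ) ∈ Icc (0 : ℝ) 1 := ⟨zero_le_one, le_rfl⟩
  by_cases hxV : x ∈ V
  · obtain ⟨y, -, ⟨i, ⟨rfl, rfl⟩ | ⟨rfl, rfl⟩⟩, hlt⟩ := hv hxV
    · exact ⟨i, 1, h1, 0, h0, D.one_mem i, rfl, by
        rwa [D.extend_of_mem f (D.one_mem i), D.extend_of_mem f (D.zero_mem i)]⟩
    · exact ⟨i, 0, h0, 1, h1, D.zero_mem i, rfl, by
        rwa [D.extend_of_mem f (D.one_mem i), D.extend_of_mem f (D.zero_mem i)]⟩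
  · obtain ⟨i, t, ht, rfl⟩ := (D.cover x).resolve_left hxV
    have ht' := Ioo_subset_Icc_self ht
    rcases (he i t ht rfl).lt_or_gt with h | h
    · refine ⟨i, 0, h0, t, ht', D.zero_mem i, rfl, ?_⟩
      rw [D.extend_of_mem f (D.zero_mem i), D.extend_apply f i ht']
      nlinarith [ht.1]
    · refine ⟨i, 1, h1, t, ht', D.one_mem i, rfl, ?_⟩
      rw [D.extend_of_mem f (D.one_mem i), D.extend_apply f i ht']
      nlinarith [ht.2]

end EdgeDecomposition

/-- A set closed under descent is connected if each of its points outside a connected set has a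
descending arc to one of finitely many points. -/
theorem isPreconnected_of_descent {G : Type*} [TopologicalSpace G] (h : G → ℝ) (V : Finset G)
    {B S : Set G} (hB : IsConnected B) (hBS : B ⊆ S) (hS : ∀ x ∈ S, ∀ z, h z ≤ h x → z ∈ S)
    (hdesc : ∀ x ∈ S, x ∉ B → ∃ y ∈ V, h y < h x ∧ ∃ C, IsPreconnected C ∧ x ∈ C ∧ y ∈ C ∧
      ∀ z ∈ C, z ≠ x → h z < h x) : IsPreconnected S := by
  classical
  obtain ⟨b, hb⟩ := hB.nonempty
  refine isPreconnected_of_forall b ?_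
  suffices ∀ n, ∀ y ∈ S, (V.filter (fun v => h v < h y)).card = n →
      ∃ t ⊆ S, b ∈ t ∧ y ∈ t ∧ IsPreconnected t from fun y hy => this _ y hy rfl
  intro n
  induction n using Nat.strong_induction_on with
  | _ n ih =>
  intro x hx hn
  by_cases hxB : x ∈ B
  · exact ⟨B, hBS, hb, hxB, hB.isPreconnected⟩
  obtain ⟨y, hyV, hyx, C, hC, hxC, hyC, hlt⟩ := hdesc x hx hxB
  have hcard : (V.filter (fun v => h v < h y)).card < n := by
    rw [← hn]
    refine Finset.card_lt_card ⟨?_, ?_⟩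
    · exact Finset.monotone_filter_right V fun v _ hv => hv.trans hyx
    · intro hsub
      have := hsub (Finset.mem_filter.2 ⟨hyV, hyx⟩)
      exact lt_irrefl _ (Finset.mem_filter.1 this).2
  obtain ⟨t, htS, hbt, hyt, ht⟩ := ih _ hcard y (hS x hx y hyx.le) rfl
  refine ⟨t ∪ C, union_subset htS ?_, Or.inl hbt, Or.inr hxC, ht.union y hyt hyC hC⟩
  intro z hz
  rcases eq_or_ne z x with rfl | hne
  · exact hx
  · exact hS x hx z (hlt z hz hne).le

theorem exists_lt_mem_of_descent {G : Type*} [TopologicalSpace G] [T1Space G] {h : G → ℝ}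
    {x y : G} (hyx : h y < h x) {C : Set G} (hC : IsPreconnected C) (hx : x ∈ C) (hy : y ∈ C)
    (hlt : ∀ z ∈ C, z ≠ x → h z < h x) {U : Set G} (hU : IsOpen U) (hxU : x ∈ U) :
    ∃ z ∈ U, h z < h x := by
  have hne : y ≠ x := fun e => hyx.ne (e ▸ rfl)
  obtain ⟨z, hz, hzx⟩ := accPt_iff_nhds.1
    (hC.preperfect_of_nontrivial ⟨x, hx, y, hy, hne.symm⟩ x hx) U (hU.mem_nhds hxU)
  exact ⟨z, hz.1, hlt z hz.2 hzx⟩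

/-- Every point outside `A` starts a descending arc for `h` and, unless it is `p`, an ascending
one, where the arcs end in a finite set and `h` vanishes exactly on `A`. -/
theorem exists_bipolar_height {G : Type u} [TopologicalSpace G] [T2Space G] [ConnectedSpace G]
    (hfg : IsFiniteGraph G) (htangle : ∀ q : G, IsPreconnected ({q}ᶜ : Set G))
    {p : G} {A : Set G} (hAcl : IsClosed A) (hAne : A.Nonempty) (hAc : IsPreconnected Aᶜ)
    (hp : p ∉ A) :
    ∃ (h : G → ℝ) (V : Finset G), Continuous h ∧ (∀ x, h x ≤ 1) ∧ h p = 1 ∧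
      (∀ x, h x ≤ 0 ↔ x ∈ A) ∧
      (∀ x ∉ A, ∃ y ∈ V, h y < h x ∧ ∃ C, IsPreconnected C ∧ x ∈ C ∧ y ∈ C ∧
        ∀ z ∈ C, z ≠ x → h z < h x) ∧
      (∀ x ∉ A, x ≠ p → ∃ y ∈ V, h x < h y ∧ ∃ C, IsPreconnected C ∧ x ∈ C ∧ y ∈ C ∧
        ∀ z ∈ C, z ≠ x → h x < h z) := by
  classical
  obtain ⟨V₀, hV₀⟩ := hfg.exists_edgeDecomposition
  obtain ⟨D₁⟩ := hV₀ (insert p V₀) (Finset.subset_insert _ _)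
  have hfr := D₁.finite_frontier hAcl hAc (Finset.mem_insert_self p V₀) hp
  obtain ⟨D⟩ := hV₀ (insert p V₀ ∪ hfr.toFinset)
    ((Finset.subset_insert _ _).trans Finset.subset_union_left)
  have hpV : p ∈ insert p V₀ ∪ hfr.toFinset := by simp
  have hfrV : frontier A ⊆ ((insert p V₀ ∪ hfr.toFinset : Finset G) : Set G) := fun x hx =>
    Finset.mem_coe.2 (Finset.mem_union_right _ (hfr.mem_toFinset.2 hx))
  generalize insert p V₀ ∪ hfr.toFinset = V at D hpV hfrV
  set T := V.filter (· ∉ A)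
  have hT : ∀ x, x ∈ T ↔ x ∈ V ∧ x ∉ A := fun x => Finset.mem_filter
  have hpT : p ∈ T := (hT p).2 ⟨hpV, hp⟩
  obtain ⟨s, hsV, hsA⟩ : ∃ s ∈ V, s ∈ A := by
    obtain ⟨s, hs⟩ := nonempty_frontier_iff.2 ⟨hAne, fun e => hp (e ▸ mem_univ p)⟩
    exact ⟨s, hfrV hs, hAcl.frontier_subset hs⟩
  have hsT : s ∉ T := fun h => ((hT s).1 h).2 hsA
  have herase : ∀ v ∈ V, CutConnected D.Adj (V.erase v) := by
    intro v _
    convert D.cutConnected_filter (htangle v) using 1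
    ext x
    simp [and_comm]
  have hVconn : CutConnected D.Adj V := by
    have := D.cutConnected_filter (K := ∅) (by simpa using isPreconnected_univ)
    simpa using this
  have hout : ∃ u ∈ V \ T, ∃ v ∈ T, D.Adj v u := by
    by_contra! hcon
    have := hVconn T (Finset.filter_subset _ _) ⟨p, hpT⟩ (by
      intro x hx y hy hxy
      by_contra hyT
      exact hcon y (Finset.mem_sdiff.2 ⟨hy, hyT⟩) x hx hxy)
    exact hsT (this ▸ hsV)
  obtain ⟨g, hg0, hginj, hgp, hlow, hhigh⟩ := exists_st_numbering D.adj_symm hsV herase _ T rfl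
    (Finset.filter_subset _ _) hpT hsT (D.cutConnected_filter hAc) hout
  have hgpos : ∀ x ∈ T, 0 < g x := fun x hx =>
    Nat.pos_of_ne_zero fun e => (hg0 x).1 e hx
  have hgp0 : (0 : ℝ) < g p := Nat.cast_pos.2 (hgpos p hpT)
  let f : G → ℝ := fun x => g x / g p
  have hflt : ∀ x y, f x < f y ↔ g x < g y := fun x y => by
    rw [div_lt_div_iff_of_pos_right hgp0, Nat.cast_lt]
  have hf0 : ∀ x, 0 ≤ f x := fun x => by positivity
  have hf1 : ∀ x, f x ≤ 1 := fun x => by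
    rw [div_le_one hgp0]
    exact_mod_cast hgp x
  have hfA : ∀ x ∈ A, f x = 0 := fun x hx => by
    have : g x = 0 := (hg0 x).2 fun h => ((hT x).1 h).2 hx
    simp [f, this]
  have hfpos : ∀ x ∈ V, x ∉ A → 0 < f x := fun x hx hxA =>
    div_pos (Nat.cast_pos.2 (hgpos x ((hT x).2 ⟨hx, hxA⟩))) hgp0
  have hends : ∀ i, ∀ t ∈ Ioo (0 : ℝ) 1, D.γ i t ∉ A → D.γ i 0 ∉ A ∨ D.γ i 1 ∉ A := by
    intro i t ht htA
    by_contra! h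
    exact htA (D.image_Icc_subset hAc hpV hp i le_rfl le_rfl h.1 h.2
      ⟨t, Ioo_subset_Icc_self ht, rfl⟩)
  have hne : ∀ i, ∀ t ∈ Ioo (0 : ℝ) 1, D.γ i t ∉ A → f (D.γ i 0) ≠ f (D.γ i 1) := by
    intro i t ht htA heq
    have h01 : D.γ i 0 ≠ D.γ i 1 := fun e =>
      zero_ne_one (D.injOn i ⟨le_rfl, zero_le_one⟩ ⟨zero_le_one, le_rfl⟩ e)
    have hgeq : g (D.γ i 0) = g (D.γ i 1) := by
      have h1 := (hflt (D.γ i 0) (D.γ i 1)).not.1 heq.not_lt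
      have h2 := (hflt (D.γ i 1) (D.γ i 0)).not.1 heq.not_gt
      omega
    have hmem : D.γ i 0 ∈ T ↔ D.γ i 1 ∈ T := by
      rw [← not_iff_not, ← hg0, ← hg0, hgeq]
    rcases hends i t ht htA with h | h
    · have h0 := (hT _).2 ⟨D.zero_mem i, h⟩
      exact h01 (hginj h0 (hmem.1 h0) hgeq)
    · have h1 := (hT _).2 ⟨D.one_mem i, h⟩
      exact h01 (hginj (hmem.2 h1) h1 hgeq)
  refine ⟨D.extend f, V, D.continuous_extend f, ?_, ?_, ?_, ?_, ?_⟩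
  · intro x
    rcases D.cover x with hx | ⟨i, t, ht, rfl⟩
    · rw [D.extend_of_mem f hx]
      exact hf1 x
    · rw [D.extend_apply f i (Ioo_subset_Icc_self ht)]
      nlinarith [hf1 (D.γ i 0), hf1 (D.γ i 1), ht.1, ht.2]
  · rw [D.extend_of_mem f hpV]
    exact div_self hgp0.ne'
  · intro x
    rcases D.cover x with hx | ⟨i, t, ht, rfl⟩
    · rw [D.extend_of_mem f hx]
      exact ⟨fun h => by_contra fun hxA => (hfpos x hx hxA).not_ge h, fun h => (hfA x h).le⟩
    · rw [D.extend_apply f i (Ioo_subset_Icc_self ht)]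
      constructor
      · intro h
        by_contra htA
        have h0 := hf0 (D.γ i 0)
        have h1 := hf0 (D.γ i 1)
        rcases hends i t ht htA with h' | h'
        · nlinarith [hfpos _ (D.zero_mem i) h', ht.1, ht.2]
        · nlinarith [hfpos _ (D.one_mem i) h', ht.1, ht.2]
      · intro htA
        have hsub := D.image_Icc_subset_of_frontier_subset hAcl hfrV ht htA
        rw [hfA _ (hsub ⟨0, ⟨le_rfl, zero_le_one⟩, rfl⟩),
          hfA _ (hsub ⟨1, ⟨zero_le_one, le_rfl⟩, rfl⟩)]
        simp
  · intro x hxA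
    refine D.exists_descent f x (fun hx => ?_) ?_
    · obtain ⟨y, hy, hxy, hlt⟩ := hlow x ((hT x).2 ⟨hx, hxA⟩)
      exact ⟨y, hy, hxy, (hflt y x).2 hlt⟩
    · rintro i t ht rfl
      exact hne i t ht hxA
  · intro x hxA hxp
    have := D.exists_descent (fun y => -f y) x (fun hx => ?_) ?_
    · simpa only [D.extend_neg, neg_lt_neg_iff] using this
    · obtain ⟨y, hy, hxy, hlt⟩ := hhigh x ((hT x).2 ⟨hx, hxA⟩) hxp
      exact ⟨y, hy, hxy, neg_lt_neg ((hflt x y).2 hlt)⟩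
    · rintro i t ht rfl h
      exact hne i t ht hxA (neg_injective h)

/-- The sublevel sets of a continuous function without local minima above level `0` depend
continuously on the level. -/
theorem continuous_sublevel {G : Type*} [MetricSpace G] [CompactSpace G] {h : G → ℝ}
    (hcont : Continuous h)
    (hmin : ∀ x, 0 < h x → ∀ U, IsOpen U → x ∈ U → ∃ z ∈ U, h z < h x)
    {α : unitInterval → NonemptyCompacts G} (hα : ∀ t, (α t : Set G) = {x | h x ≤ t}) :
    Continuous α := by
  let := TopologicalSpace.vietoris G
  rw [NonemptyCompacts.isEmbedding_coe.continuous_iff, vietoris.continuous_iff]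
  simp only [Function.comp_def, hα]
  constructor
  · intro U hU
    have hcl : IsClosed ((↑) ⁻¹' {r : ℝ | ∃ x ∈ Uᶜ, h x ≤ r} : Set unitInterval) := by
      refine IsClosed.preimage continuous_subtype_val ?_
      rcases Uᶜ.eq_empty_or_nonempty with hE | hne
      · simp [hE]
      obtain ⟨x, hx, hmin⟩ := hU.isClosed_compl.isCompact.exists_isMinOn hne hcont.continuousOn
      convert isClosed_Ici (a := h x) using 1
      ext r
      exact ⟨fun ⟨y, hy, hyr⟩ => (hmin hy).trans hyr, fun hr => ⟨x, hx, hr⟩⟩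
    convert hcl.isOpen_compl using 1
    ext t
    simp only [mem_preimage, mem_powerset_iff, subset_def, mem_ofPred, mem_compl_iff, not_exists,
      not_and]
    exact forall_congr' fun x => not_imp_not.symm
  · intro F hF
    rw [← isOpen_compl_iff, isOpen_iff_mem_nhds]
    intro t ht
    obtain ⟨x, hx, hxF⟩ := not_subset.1 ht
    rcases le_or_gt (h x) 0 with h0 | h0
    · exact Filter.Eventually.of_forall fun s hs => hxF (hs (h0.trans s.2.1))
    · obtain ⟨z, hz, hlt⟩ := hmin x h0 Fᶜ hF.isOpen_compl hxF
      have hopen : IsOpen {s : unitInterval | h z < s} :=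
        isOpen_lt continuous_const continuous_subtype_val
      filter_upwards [hopen.mem_nhds (hlt.trans_le hx)] with s hs hsub
      exact hz (hsub (le_of_lt hs))

/-- If G is a finite graph continuum without cut-points (a tangle), p ∈ G,
and A ∈ NC*(G) with p ∉ A, then there is a path in NC*(G) from A to G avoiding p
except possibly at time 1. -/
theorem stmt7 {G : Type*} [MetricSpace G] [CompactSpace G] [ConnectedSpace G] [Nontrivial G]
    (hfg : IsFiniteGraph G) (htangle : ∀ q : G, IsPreconnected ({q}ᶜ : Set G))
    (p : G) (A : NonemptyCompacts G)
    (hAconn : IsConnected (A : Set G)) (hAc : IsPreconnected ((A : Set G)ᶜ))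
    (hp : p ∉ (A : Set G)) :
    ∃ α : unitInterval → NonemptyCompacts G, Continuous α ∧
      α 0 = A ∧ (α 1 : Set G) = Set.univ ∧
      (∀ t, IsConnected ((α t : Set G)) ∧ IsPreconnected ((α t : Set G)ᶜ)) ∧
      (∀ t : unitInterval, (t : ℝ) < 1 → p ∉ (α t : Set G)) := by
  obtain ⟨h, V, hcont, h1, hp1, h0, hdown, hup⟩ :=
    exists_bipolar_height hfg htangle A.isCompact.isClosed A.nonempty hAc hp
  have hA0 : ∀ {t : ℝ}, 0 ≤ t → (A : Set G) ⊆ {x | h x ≤ t} := fun ht x hx =>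
    ((h0 x).2 hx).trans ht
  let α : unitInterval → NonemptyCompacts G := fun t =>
    ⟨⟨{x | h x ≤ t}, (isClosed_le hcont continuous_const).isCompact⟩,
      A.nonempty.mono (hA0 t.2.1)⟩
  have hα : ∀ t, (α t : Set G) = {x | h x ≤ t} := fun t => rfl
  refine ⟨α, continuous_sublevel hcont ?_ hα, ?_, ?_, ?_, ?_⟩
  · intro x hx U hU hxU
    obtain ⟨y, -, hyx, C, hC, hxC, hyC, hlt⟩ := hdown x fun hxA => hx.not_ge ((h0 x).2 hxA)
    exact exists_lt_mem_of_descent hyx hC hxC hyC hlt hU hxU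
  · refine NonemptyCompacts.ext ?_
    rw [hα]
    ext x
    exact h0 x
  · rw [hα]
    exact eq_univ_of_forall h1
  · intro t
    rw [hα]
    refine ⟨⟨A.nonempty.mono (hA0 t.2.1), ?_⟩, ?_⟩
    · exact isPreconnected_of_descent h V hAconn (hA0 t.2.1)
        (fun x hx z hz => le_trans hz hx) (fun x _ hxA => hdown x hxA)
    · rcases t.2.2.eq_or_lt with ht | ht
      · have : {x | h x ≤ t}ᶜ = ∅ := by
          rw [compl_empty_iff, ht]
          exact eq_univ_of_forall h1
        rw [this]
        exact isPreconnected_empty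
      refine isPreconnected_of_descent (fun x => -h x) V (isConnected_singleton (x := p)) ?_ ?_ ?_
      · rw [singleton_subset_iff]
        exact fun hle => (ht.trans_eq hp1.symm).not_ge hle
      · exact fun x hx z hz hzt => hx ((neg_le_neg_iff.1 hz).trans hzt)
      · intro x hx hxp
        simpa only [neg_lt_neg_iff] using hup x (fun hxA => hx (hA0 t.2.1 hxA)) hxp
  · intro t ht hpt
    exact (ht.trans_eq hp1.symm).not_ge hpt
end

section
/- Let G be a finite graph. Then NC*(G) is connected if and only if NC*(G) is path-connected. -/
open TopologicalSpace Set

/-- A set covered by finitely many cells, each joined within the set to all points of the set in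
its closure, is path-connected as soon as it is connected. -/
theorem isPathConnected_of_finite_cells {Y ι : Type*} [TopologicalSpace Y] [Finite ι] {S : Set Y}
    (C : ι → Set Y) (hcover : S ⊆ ⋃ i, C i)
    (hjoin : ∀ i, ∀ x ∈ C i, ∀ y ∈ closure (C i), y ∈ S → JoinedIn S x y)
    (hS : IsConnected S) : IsPathConnected S := by
  obtain ⟨⟨x, hx⟩, hpre⟩ := hS
  refine ⟨x, hx, fun {y} hy ↦ ?_⟩
  by_contra hxy
  have hclosed (J : Set ι) : IsClosed (⋃ i ∈ J, closure (C i)) :=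
    J.toFinite.isClosed_biUnion fun _ _ ↦ isClosed_closure
  set J : Set ι := {i | ∃ z ∈ C i, JoinedIn S x z}
  have hJ (z : Y) (hz : z ∈ S) (h : z ∈ ⋃ i ∈ J, closure (C i)) : JoinedIn S x z := by
    simp only [mem_iUnion, exists_prop] at h
    obtain ⟨i, ⟨w, hw, hxw⟩, hzi⟩ := h
    exact hxw.trans (hjoin i w hw z hzi hz)
  have hJc (z : Y) (hz : z ∈ S) (h : z ∈ ⋃ i ∈ Jᶜ, closure (C i)) : ¬ JoinedIn S x z := by
    simp only [mem_iUnion, exists_prop] at h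
    obtain ⟨i, hi, hzi⟩ := h
    obtain ⟨w, hw⟩ := closure_nonempty_iff.1 ⟨z, hzi⟩
    exact fun hxz ↦ hi ⟨w, hw, hxz.trans (hjoin i w hw z hzi hz).symm⟩
  have hmem (z : Y) (hz : z ∈ S) :
      z ∈ (⋃ i ∈ J, closure (C i)) ∪ ⋃ i ∈ Jᶜ, closure (C i) := by
    obtain ⟨i, hi⟩ := mem_iUnion.1 (hcover hz)
    by_cases h : i ∈ J
    · exact .inl (mem_biUnion h (subset_closure hi))
    · exact .inr (mem_biUnion h (subset_closure hi))
  obtain ⟨z, hz, hz1, hz2⟩ := isPreconnected_closed_iff.1 hpre _ _ (hclosed J) (hclosed Jᶜ) hmem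
    ⟨x, hx, (hmem x hx).resolve_right fun h ↦ hJc x hx h (.refl hx)⟩
    ⟨y, hy, (hmem y hy).resolve_left fun h ↦ hxy (hJ y hy h)⟩
  exact hJc z hz hz2 (hJ z hz hz1)

/-- If `P ⊆ K` with `K` compact and `P` absorbs half-open segments from `P` to `K`, then the image
of `P` under a continuous map is joined to the points of its closure. -/
theorem joinedIn_of_mem_closure_image {V Y : Type*} [AddCommGroup V] [Module ℝ V]
    [TopologicalSpace V] [ContinuousAdd V] [ContinuousSMul ℝ V] [TopologicalSpace Y] [T2Space Y]
    {P K : Set V} {S : Set Y} {f : V → Y} (hf : Continuous f) (hK : IsCompact K) (hPK : P ⊆ K)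
    (hseg : ∀ q ∈ P, ∀ p ∈ K, ∀ t : ℝ, 0 ≤ t → t < 1 → (1 - t) • q + t • p ∈ P)
    (hPS : ∀ q ∈ P, f q ∈ S) {x y : Y} (hx : x ∈ f '' P) (hy : y ∈ closure (f '' P))
    (hyS : y ∈ S) : JoinedIn S x y := by
  obtain ⟨q, hq, rfl⟩ := hx
  obtain ⟨p, hp, rfl⟩ := closure_minimal (image_mono hPK) (hK.image hf).isClosed hy
  refine JoinedIn.ofLine (f := fun t ↦ f ((1 - t) • q + t • p))
    (Continuous.continuousOn (by fun_prop)) (by simp) (by simp) ?_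
  rintro _ ⟨t, ⟨h0, h1⟩, rfl⟩
  rcases h1.lt_or_eq with h1 | rfl
  · exact hPS _ (hseg q hq p hp t h0 h1)
  · simpa using hyS

/-- The position of `u` in the unit interval relative to the endpoints and two marks `s`, `t`. -/
noncomputable def markPosition (s t u : unitInterval) : Ordering × Ordering × Ordering × Ordering :=
  (cmp u 0, cmp u s, cmp u t, cmp u 1)

theorem StrictMono.markPosition_map {f : unitInterval → unitInterval} (hf : StrictMono f)
    (h0 : f 0 = 0) (h1 : f 1 = 1) (s t u : unitInterval) :
    markPosition (f s) (f t) (f u) = markPosition s t u := by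
  simp only [markPosition, hf.cmp_map_eq]
  congr 1
  · rw [← hf.cmp_map_eq u, h0]
  · congr 2
    rw [← hf.cmp_map_eq u, h1]

theorem exists_marks_cmp {a b : unitInterval} (hab : a ≤ b) :
    ∃ s t : unitInterval, 0 < s ∧ s < t ∧ t < 1 ∧
      ∀ u v, markPosition s t u = markPosition s t v → cmp u a = cmp v a ∧ cmp u b = cmp v b := by
  suffices h : ∃ s t : unitInterval, 0 < s ∧ s < t ∧ t < 1 ∧
      (a = 0 ∨ a = s ∨ a = t ∨ a = 1) ∧ (b = 0 ∨ b = s ∨ b = t ∨ b = 1) by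
    obtain ⟨s, t, h0, hst, h1, ha, hb⟩ := h
    refine ⟨s, t, h0, hst, h1, fun u v h ↦ ?_⟩
    simp only [markPosition, Prod.mk.injEq] at h
    grind
  by_cases ha : 0 < a ∧ a < 1
  · by_cases hb : a < b ∧ b < 1
    · exact ⟨a, b, ha.1, hb.1, hb.2, by simp, by simp⟩
    · obtain ⟨e, h1, h2⟩ := exists_between ha.2
      refine ⟨a, e, ha.1, h1, h2, by simp, ?_⟩
      by_cases h : a < b
      · exact .inr <| .inr <| .inr <| le_antisymm b.2.2 (not_lt.1 fun h' ↦ hb ⟨h, h'⟩)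
      · exact .inr <| .inl <| le_antisymm (not_lt.1 h) hab
  · have ha' : a = 0 ∨ a = 1 := by
      by_cases h : 0 < a
      · exact .inr <| le_antisymm a.2.2 (not_lt.1 fun h' ↦ ha ⟨h, h'⟩)
      · exact .inl <| le_antisymm (not_lt.1 h) a.2.1
    by_cases hb : 0 < b ∧ b < 1
    · obtain ⟨e, h1, h2⟩ := exists_between hb.2
      exact ⟨b, e, hb.1, h1, h2, by tauto, by simp⟩
    · have hb' : b = 0 ∨ b = 1 := by
        by_cases h : 0 < b
        · exact .inr <| le_antisymm b.2.2 (not_lt.1 fun h' ↦ hb ⟨h, h'⟩)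
        · exact .inl <| le_antisymm (not_lt.1 h) b.2.1
      obtain ⟨t, h1, h2⟩ := exists_between (zero_lt_one (α := unitInterval))
      obtain ⟨s, h3, h4⟩ := exists_between h1
      exact ⟨s, t, h3, h4, h2, by tauto, by tauto⟩

theorem Set.OrdConnected.exists_marks {Z : Set unitInterval} (hZ : Z.OrdConnected) :
    ∃ s t : unitInterval, 0 < s ∧ s < t ∧ t < 1 ∧
      ∀ u v, markPosition s t u = markPosition s t v → (u ∈ Z ↔ v ∈ Z) := by
  rcases Z.eq_empty_or_nonempty with rfl | hne
  · obtain ⟨s, t, h0, hst, h1, -⟩ := exists_marks_cmp (le_refl (0 : unitInterval))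
    exact ⟨s, t, h0, hst, h1, by simp⟩
  obtain ⟨z, hz⟩ := hne
  obtain ⟨s, t, h0, hst, h1, h⟩ := exists_marks_cmp ((sInf_le hz).trans (le_sSup hz))
  refine ⟨s, t, h0, hst, h1, ?_⟩
  have key (u v) (huv : markPosition s t u = markPosition s t v) (hu : u ∈ Z) : v ∈ Z := by
    obtain ⟨ha, hb⟩ := h u v huv
    rcases (sInf_le hu).eq_or_lt with h2 | h2
    · rw [h2, cmp_self_eq_eq, eq_comm, cmp_eq_eq_iff] at ha
      exact ha ▸ hu
    rcases (le_sSup hu).eq_or_lt with h3 | h3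
    · rw [← h3, cmp_self_eq_eq, eq_comm, cmp_eq_eq_iff] at hb
      exact hb ▸ hu
    rw [(cmp_eq_gt_iff _ _).2 h2, eq_comm, cmp_eq_gt_iff] at ha
    rw [(cmp_eq_lt_iff _ _).2 h3, eq_comm, cmp_eq_lt_iff] at hb
    obtain ⟨w, hw, hwv⟩ := sInf_lt_iff.1 ha
    obtain ⟨w', hw', hvw'⟩ := lt_sSup_iff.1 hb
    exact hZ.out hw hw' ⟨hwv.le, hvw'.le⟩
  exact fun u v huv ↦ ⟨key u v huv, key v u huv.symm⟩

/-- A real number clamped to the unit interval. -/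
noncomputable def clamp (y : ℝ) : ℝ := max 0 (min y 1)

/-- The piecewise linear map with `0, 1/3, 2/3, 1 ↦ 0, p.1, p.2, 1`. -/
noncomputable def bend (p : ℝ × ℝ) (x : unitInterval) : unitInterval :=
  projIcc 0 1 zero_le_one
    (p.1 * clamp (3 * x) + (p.2 - p.1) * clamp (3 * x - 1) + (1 - p.2) * clamp (3 * x - 2))

theorem continuous_bend : Continuous fun q : (ℝ × ℝ) × unitInterval ↦ bend q.1 q.2 := by
  unfold bend clamp
  refine continuous_projIcc.comp ?_
  fun_prop

theorem bend_zero (p : ℝ × ℝ) : bend p 0 = 0 := by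
  simp [bend, clamp]

theorem bend_one (p : ℝ × ℝ) : bend p 1 = 1 := by
  unfold bend clamp
  norm_num

theorem coe_bend {p : ℝ × ℝ} (h0 : 0 < p.1) (h1 : p.1 < p.2) (h2 : p.2 < 1) (x : unitInterval) :
    (bend p x : ℝ) =
      p.1 * clamp (3 * x) + (p.2 - p.1) * clamp (3 * x - 1) + (1 - p.2) * clamp (3 * x - 2) := by
  have hc0 (y : ℝ) : 0 ≤ clamp y := le_max_left _ _
  have hc1 (y : ℝ) : clamp y ≤ 1 := max_le zero_le_one (min_le_right _ _)
  rw [bend, projIcc_of_mem zero_le_one]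
  constructor
  · have := hc0 (3 * x)
    have := hc0 (3 * x - 1)
    have := hc0 (3 * x - 2)
    have := sub_pos.2 h1
    have := sub_pos.2 h2
    positivity
  · nlinarith [hc1 (3 * x), hc1 (3 * x - 1), hc1 (3 * x - 2)]

theorem bend_strictMono {p : ℝ × ℝ} (h0 : 0 < p.1) (h1 : p.1 < p.2) (h2 : p.2 < 1) :
    StrictMono (bend p) := by
  intro x y hxy
  rw [← Subtype.coe_lt_coe, coe_bend h0 h1 h2, coe_bend h0 h1 h2]
  have hc : Monotone clamp := fun a b h ↦ max_le_max le_rfl (min_le_min h le_rfl)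
  have hsum (z : unitInterval) : clamp (3 * z) + clamp (3 * z - 1) + clamp (3 * z - 2) = 3 * z := by
    have := z.2.1
    have := z.2.2
    unfold clamp
    grind
  have hxy' : (x : ℝ) < y := hxy
  have e0 : clamp (3 * x) ≤ clamp (3 * y) := hc (by linarith)
  have e1 : clamp (3 * x - 1) ≤ clamp (3 * y - 1) := hc (by linarith)
  have e2 : clamp (3 * x - 2) ≤ clamp (3 * y - 2) := hc (by linarith)
  have hx := hsum x
  have hy := hsum y
  obtain ⟨m, hm, m0, m1, m2⟩ : ∃ m : ℝ, 0 < m ∧ m ≤ p.1 ∧ m ≤ p.2 - p.1 ∧ m ≤ 1 - p.2 :=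
    ⟨min p.1 (min (p.2 - p.1) (1 - p.2)), by simp [h0, h1, h2], by simp, by simp, by simp⟩
  linear_combination mul_le_mul_of_nonneg_right m0 (sub_nonneg.2 e0) +
    mul_le_mul_of_nonneg_right m1 (sub_nonneg.2 e1) +
    mul_le_mul_of_nonneg_right m2 (sub_nonneg.2 e2) + 3 * mul_pos hm (sub_pos.2 hxy') +
    m * hx - m * hy

theorem bend_bijective {p : ℝ × ℝ} (h0 : 0 < p.1) (h1 : p.1 < p.2) (h2 : p.2 < 1) :
    Function.Bijective (bend p) :=
  ⟨(bend_strictMono h0 h1 h2).injective, fun y ↦ mem_range_of_exists_le_of_exists_ge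
    (continuous_bend.comp (Continuous.prodMk_right p)) ⟨0, (bend_zero p).trans_le y.2.1⟩
    ⟨1, (unitInterval.le_one' (t := y)).trans_eq (bend_one p).symm⟩⟩

/-- The first mark of the model interval. -/
noncomputable def oneThird : unitInterval := ⟨1 / 3, by norm_num, by norm_num⟩

/-- The second mark of the model interval. -/
noncomputable def twoThirds : unitInterval := ⟨2 / 3, by norm_num, by norm_num⟩

theorem markPosition_bend {s t : unitInterval} (h0 : 0 < s) (h1 : s < t) (h2 : t < 1)
    (u : unitInterval) :
    markPosition s t (bend (s, t) u) = markPosition oneThird twoThirds u := by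
  have h0' : (0 : ℝ) < s := h0
  have h1' : (s : ℝ) < t := h1
  have h2' : (t : ℝ) < 1 := h2
  have hs : bend (s, t) oneThird = s := by
    ext
    rw [coe_bend h0' h1' h2']
    norm_num [clamp, oneThird]
  have ht : bend (s, t) twoThirds = t := by
    ext
    rw [coe_bend h0' h1' h2']
    norm_num [clamp, twoThirds]
  have h := (bend_strictMono (p := (s, t)) h0' h1' h2').markPosition_map (bend_zero _) (bend_one _)
    oneThird twoThirds u
  rwa [hs, ht] at h

/-- The maps `φ e` are edges decomposing `G`: they cover `G`, are injective in their interiors, and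
the interior of an edge meets neither another edge nor an endpoint. -/
structure IsEdgeDecomposition {E G : Type*} [TopologicalSpace G] (φ : E → unitInterval → G) :
    Prop where
  continuous : ∀ e, Continuous (φ e)
  cover : ∀ g, ∃ e x, φ e x = g
  interior_inj : ∀ e f x y, x ≠ 0 → x ≠ 1 → φ e x = φ f y → e = f ∧ x = y

/-- Pairs of consecutive points of the finite sets `F k`. -/
abbrev Gap {K : Type*} (F : K → Finset unitInterval) :=
  {q : Σ k, F k × F k // q.2.1 < q.2.2 ∧ ∀ c ∈ F q.1, ¬ (q.2.1 < c ∧ c < q.2.2)}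

/-- The affine parametrization of the segment from `a` to `b`. -/
noncomputable def segmentMap (a b x : unitInterval) : unitInterval :=
  projIcc 0 1 zero_le_one (a + x * (b - a))

theorem continuous_segmentMap (a b : unitInterval) : Continuous (segmentMap a b) := by
  unfold segmentMap
  refine continuous_projIcc.comp ?_
  fun_prop

theorem coe_segmentMap {a b : unitInterval} (h : a < b) (x : unitInterval) :
    (segmentMap a b x : ℝ) = a + x * (b - a) := by
  have h' : (a : ℝ) < b := h
  rw [segmentMap, projIcc_of_mem zero_le_one]
  have := mul_nonneg x.2.1 (sub_nonneg.2 h'.le)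
  have := mul_le_of_le_one_left (sub_nonneg.2 h'.le) x.2.2
  exact ⟨by linarith [a.2.1], by linarith [b.2.2]⟩

theorem segmentMap_mem_Icc {a b : unitInterval} (h : a < b) (x : unitInterval) :
    segmentMap a b x ∈ Icc a b := by
  have h' : (a : ℝ) < b := h
  have := mul_nonneg x.2.1 (sub_nonneg.2 h'.le)
  have := mul_le_of_le_one_left (sub_nonneg.2 h'.le) x.2.2
  constructor <;> rw [← Subtype.coe_le_coe, coe_segmentMap h] <;> linarith

theorem segmentMap_injective {a b : unitInterval} (h : a < b) :
    Function.Injective (segmentMap a b) := by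
  intro x y hxy
  have h' : (a : ℝ) < b := h
  have := congrArg Subtype.val hxy
  rw [coe_segmentMap h, coe_segmentMap h] at this
  exact Subtype.ext (mul_right_cancel₀ (sub_pos.2 h').ne' (add_left_cancel this))

theorem segmentMap_zero {a b : unitInterval} (h : a < b) : segmentMap a b 0 = a := by
  ext; simp [coe_segmentMap h]

theorem segmentMap_one {a b : unitInterval} (h : a < b) : segmentMap a b 1 = b := by
  ext; simp [coe_segmentMap h]

theorem exists_segmentMap_eq {a b y : unitInterval} (h : a < b) (hy : y ∈ Icc a b) :
    ∃ x, segmentMap a b x = y :=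
  mem_range_of_exists_le_of_exists_ge (continuous_segmentMap a b)
    ⟨0, (segmentMap_zero h).trans_le hy.1⟩ ⟨1, hy.2.trans_eq (segmentMap_one h).symm⟩

theorem exists_gap {F : Finset unitInterval} (h0 : 0 ∈ F) (h1 : 1 ∈ F) (y : unitInterval) :
    ∃ a ∈ F, ∃ b ∈ F, a < b ∧ (∀ c ∈ F, ¬ (a < c ∧ c < b)) ∧ y ∈ Icc a b := by
  by_cases hy : y < 1
  · obtain ⟨a, ha, hmax⟩ := (F.filter (· ≤ y)).exists_max_image id
      ⟨0, Finset.mem_filter.2 ⟨h0, y.2.1⟩⟩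
    obtain ⟨b, hb, hmin⟩ := (F.filter (y < ·)).exists_min_image id
      ⟨1, Finset.mem_filter.2 ⟨h1, hy⟩⟩
    simp only [Finset.mem_filter, id] at *
    refine ⟨a, ha.1, b, hb.1, ha.2.trans_lt hb.2, fun c hc hcab ↦ ?_, ha.2, hb.2.le⟩
    rcases le_or_gt c y with h | h
    · exact hcab.1.not_ge (hmax c ⟨hc, h⟩)
    · exact hcab.2.not_ge (hmin c ⟨hc, h⟩)
  · obtain rfl : y = 1 := le_antisymm y.2.2 (not_lt.1 hy)
    obtain ⟨a, ha, hmax⟩ := (F.filter (· < 1)).exists_max_image id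
      ⟨0, Finset.mem_filter.2 ⟨h0, zero_lt_one⟩⟩
    simp only [Finset.mem_filter, id] at *
    exact ⟨a, ha.1, 1, h1, ha.2, fun c hc hcab ↦ hcab.1.not_ge (hmax c ⟨hc, hcab.2⟩),
      a.2.2, le_rfl⟩

/-- Arcs which only meet each other at finitely many parameters can be cut into edges. -/
theorem isEdgeDecomposition_gap {K G : Type*} [TopologicalSpace G] {ψ : K → unitInterval → G}
    (hcont : ∀ k, Continuous (ψ k)) (hinj : ∀ k, Function.Injective (ψ k))
    (hcover : ∀ g, ∃ k x, ψ k x = g) (F : K → Finset unitInterval) (h0 : ∀ k, 0 ∈ F k)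
    (h1 : ∀ k, 1 ∈ F k) (hF : ∀ k k' x x', ψ k x = ψ k' x' → x ∉ F k → k = k') :
    IsEdgeDecomposition fun e : Gap F ↦ ψ e.1.1 ∘ segmentMap e.1.2.1 e.1.2.2 where
  continuous e := (hcont _).comp (continuous_segmentMap _ _)
  cover g := by
    obtain ⟨k, y, rfl⟩ := hcover g
    obtain ⟨a, ha, b, hb, hab, hgap, hy⟩ := exists_gap (h0 k) (h1 k) y
    obtain ⟨x, rfl⟩ := exists_segmentMap_eq hab hy
    exact ⟨⟨⟨k, ⟨a, ha⟩, ⟨b, hb⟩⟩, hab, hgap⟩, x, rfl⟩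
  interior_inj := by
    rintro ⟨⟨k, ⟨a, ha⟩, ⟨b, hb⟩⟩, hab, hgap⟩ ⟨⟨k', ⟨a', ha'⟩, ⟨b', hb'⟩⟩, hab', hgap'⟩ x x' hx0 hx1
      heq
    dsimp only [Function.comp_apply] at *
    have hy := segmentMap_mem_Icc hab x
    have hy' := segmentMap_mem_Icc hab' x'
    have hya : a < segmentMap a b x := hy.1.lt_of_ne fun h ↦
      hx0 (segmentMap_injective hab (h.symm.trans (segmentMap_zero hab).symm))
    have hyb : segmentMap a b x < b := hy.2.lt_of_ne fun h ↦
      hx1 (segmentMap_injective hab (h.trans (segmentMap_one hab).symm))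
    have hyF : segmentMap a b x ∉ F k := fun h ↦ hgap _ h ⟨hya, hyb⟩
    obtain rfl := hF _ _ _ _ heq hyF
    have hyy := hinj k heq
    rw [← hyy] at hy'
    have hya' : a' < segmentMap a b x := hy'.1.lt_of_ne fun h ↦ hyF (h ▸ ha')
    have hyb' : segmentMap a b x < b' := hy'.2.lt_of_ne fun h ↦ hyF (h ▸ hb')
    obtain rfl : a = a' := le_antisymm
      (not_lt.1 fun h ↦ hgap' _ ha ⟨h, hya.trans hyb'⟩)
      (not_lt.1 fun h ↦ hgap _ ha' ⟨h, hya'.trans hyb⟩)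
    obtain rfl : b = b' := le_antisymm
      (not_lt.1 fun h ↦ hgap _ hb' ⟨hya.trans hyb', h⟩)
      (not_lt.1 fun h ↦ hgap' _ hb ⟨hya.trans hyb, h⟩)
    exact ⟨rfl, segmentMap_injective hab hyy⟩

theorem IsFiniteGraph.exists_isEdgeDecomposition.{u} {G : Type u} [TopologicalSpace G]
    (hG : IsFiniteGraph G) :
    ∃ (K : Type u) (_ : Finite K) (φ : K → unitInterval → G), IsEdgeDecomposition φ := by
  obtain ⟨𝒜, hcover, harc, hinter⟩ := hG
  let h (A : 𝒜) : unitInterval ≃ₜ A.1 := (harc A A.2).some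
  let ψ (A : 𝒜) (x : unitInterval) : G := h A x
  have hψ (A : 𝒜) : Function.Injective (ψ A) := Subtype.val_injective.comp (h A).injective
  have hfin (A : 𝒜) : (⋃ B ∈ {B : 𝒜 | A ≠ B}, ψ A ⁻¹' (A.1 ∩ B.1)).Finite :=
    (toFinite _).biUnion fun B hB ↦ (hinter A A.2 B B.2 (Subtype.coe_ne_coe.2 hB)).preimage
      (hψ A).injOn
  refine ⟨_, inferInstance, _, isEdgeDecomposition_gap (ψ := ψ)
    (fun A ↦ continuous_subtype_val.comp (h A).continuous) hψ (fun g ↦ ?_)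
    (fun A ↦ insert 0 (insert 1 (hfin A).toFinset)) (by simp) (by simp) fun A B x x' hx hxF ↦ ?_⟩
  · obtain ⟨A, hA, hg⟩ := mem_iUnion₂.1 (hcover.ge (mem_univ g))
    exact ⟨⟨A, hA⟩, (h ⟨A, hA⟩).symm ⟨g, hg⟩, by simp [ψ]⟩
  · by_contra hAB
    refine hxF (Finset.mem_insert_of_mem (Finset.mem_insert_of_mem ?_))
    exact (hfin A).mem_toFinset.2 (mem_biUnion (x := B) hAB
      ⟨(h A x).2, hx ▸ (h B x').2⟩)

section EdgeMap

variable {E G : Type*} [TopologicalSpace G] {φ : E → unitInterval → G}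

/-- Admissible positions of the two marks on every edge. -/
def markSpace (E : Type*) : Set (E → ℝ × ℝ) :=
  {p | ∀ e, 0 < (p e).1 ∧ (p e).1 < (p e).2 ∧ (p e).2 < 1}

/-- Limits of admissible positions of the marks. -/
def closedMarkSpace (E : Type*) : Set (E → ℝ × ℝ) :=
  Icc 0 1 ∩ {p | ∀ e, (p e).1 ≤ (p e).2}

theorem isCompact_closedMarkSpace : IsCompact (closedMarkSpace E) := by
  refine isCompact_Icc.inter_right ?_
  simp only [ofPred_forall]
  exact isClosed_iInter fun e ↦ isClosed_le (by fun_prop) (by fun_prop)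

theorem markSpace_subset_closedMarkSpace : markSpace E ⊆ closedMarkSpace E := fun _ hp ↦
  ⟨⟨fun e ↦ ⟨(hp e).1.le, ((hp e).1.trans (hp e).2.1).le⟩,
    fun e ↦ ⟨((hp e).2.1.trans (hp e).2.2).le, (hp e).2.2.le⟩⟩, fun e ↦ (hp e).2.1.le⟩

theorem segment_mem_markSpace {q p : E → ℝ × ℝ} (hq : q ∈ markSpace E)
    (hp : p ∈ closedMarkSpace E) {t : ℝ} (h0 : 0 ≤ t) (h1 : t < 1) :
    (1 - t) • q + t • p ∈ markSpace E := by
  intro e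
  obtain ⟨q0, q1, q2⟩ := hq e
  have p0 : 0 ≤ (p e).1 := (hp.1.1 e).1
  have p1 : (p e).1 ≤ (p e).2 := hp.2 e
  have p2 : (p e).2 ≤ 1 := (hp.1.2 e).2
  have ht := sub_pos.2 h1
  simp only [Pi.add_apply, Pi.smul_apply, Prod.fst_add, Prod.snd_add, Prod.smul_fst,
    Prod.smul_snd, smul_eq_mul]
  refine ⟨?_, ?_, ?_⟩
  · positivity
  · exact add_lt_add_of_lt_of_le (mul_lt_mul_of_pos_left q1 ht) (mul_le_mul_of_nonneg_left p1 h0)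
  · linarith [mul_lt_mul_of_pos_left q2 ht, mul_le_mul_of_nonneg_left p2 h0]

namespace IsEdgeDecomposition

/-- The self-map of `G` bending every edge according to `p`. -/
noncomputable def edgeMap (hφ : IsEdgeDecomposition φ) (p : E → ℝ × ℝ) (g : G) : G :=
  φ (hφ.cover g).choose (bend (p (hφ.cover g).choose) (hφ.cover g).choose_spec.choose)

theorem edgeMap_apply (hφ : IsEdgeDecomposition φ) (p : E → ℝ × ℝ) (e : E) (x : unitInterval) :
    hφ.edgeMap p (φ e x) = φ e (bend (p e) x) := by
  have hspec := (hφ.cover (φ e x)).choose_spec.choose_spec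
  rw [edgeMap]
  generalize (hφ.cover (φ e x)).choose_spec.choose = x' at hspec ⊢
  generalize (hφ.cover (φ e x)).choose = e' at hspec ⊢
  by_cases hx' : x' = 0 ∨ x' = 1
  · by_cases hx : x = 0 ∨ x = 1
    · rcases hx' with rfl | rfl <;> rcases hx with rfl | rfl <;>
        simpa only [bend_zero, bend_one] using hspec
    · push Not at hx
      obtain ⟨rfl, rfl⟩ := hφ.interior_inj _ _ _ _ hx.1 hx.2 hspec.symm
      rfl
  · push Not at hx'
    obtain ⟨rfl, rfl⟩ := hφ.interior_inj _ _ _ _ hx'.1 hx'.2 hspec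
    rfl

theorem continuous_edgeMap [Finite E] [T2Space G] (hφ : IsEdgeDecomposition φ) :
    Continuous hφ.edgeMap.uncurry := by
  refine continuous_iff_isClosed.2 fun C hC ↦ ?_
  have hpre : hφ.edgeMap.uncurry ⁻¹' C = ⋃ e, Prod.map id (φ e) ''
      ((fun q : (E → ℝ × ℝ) × unitInterval ↦ φ e (bend (q.1 e) q.2)) ⁻¹' C) := by
    ext ⟨p, g⟩
    simp only [mem_preimage, mem_iUnion, mem_image, Prod.exists, Prod.map_apply, id, Prod.mk.injEq]
    constructor
    · intro h
      obtain ⟨e, x, rfl⟩ := hφ.cover g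
      exact ⟨e, p, x, (congrArg (· ∈ C) (hφ.edgeMap_apply p e x)).mp h, rfl, rfl⟩
    · rintro ⟨e, p, x, h, rfl, rfl⟩
      exact (congrArg (· ∈ C) (hφ.edgeMap_apply p e x)).mpr h
  rw [hpre]
  refine isClosed_iUnion_of_finite fun e ↦
    (isProperMap_id.prodMap (hφ.continuous e).isProperMap).isClosedMap _ (hC.preimage ?_)
  exact (hφ.continuous e).comp (continuous_bend.comp (by fun_prop :
    Continuous fun q : (E → ℝ × ℝ) × unitInterval ↦ (q.1 e, q.2)))

theorem edgeMap_bijective (hφ : IsEdgeDecomposition φ) {p : E → ℝ × ℝ} (hp : p ∈ markSpace E) :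
    Function.Bijective (hφ.edgeMap p) := by
  have hb (e : E) := bend_bijective (hp e).1 (hp e).2.1 (hp e).2.2
  constructor
  · intro g g' h
    obtain ⟨e, x, rfl⟩ := hφ.cover g
    obtain ⟨e', x', rfl⟩ := hφ.cover g'
    rw [edgeMap_apply, edgeMap_apply] at h
    have hend (e : E) (y : unitInterval) : (bend (p e) y ≠ 0 ∧ bend (p e) y ≠ 1) ∨
        bend (p e) y = y := by
      by_cases h0 : y = 0
      · exact .inr (h0 ▸ bend_zero _)
      by_cases h1 : y = 1
      · exact .inr (h1 ▸ bend_one _)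
      · exact .inl ⟨fun h ↦ h0 ((hb e).1 (h.trans (bend_zero _).symm)),
          fun h ↦ h1 ((hb e).1 (h.trans (bend_one _).symm))⟩
    rcases hend e x with hx | hx
    · obtain ⟨rfl, h⟩ := hφ.interior_inj _ _ _ _ hx.1 hx.2 h
      rw [(hb e).1 h]
    rcases hend e' x' with hx' | hx'
    · obtain ⟨rfl, h⟩ := hφ.interior_inj _ _ _ _ hx'.1 hx'.2 h.symm
      rw [(hb e').1 h]
    · rwa [hx, hx'] at h
  · intro g
    obtain ⟨e, y, rfl⟩ := hφ.cover g
    obtain ⟨x, rfl⟩ := (hb e).2 y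
    exact ⟨φ e x, hφ.edgeMap_apply p e x⟩

theorem exists_homeomorph_edgeMap [Finite E] [CompactSpace G] [T2Space G]
    (hφ : IsEdgeDecomposition φ) {p : E → ℝ × ℝ} (hp : p ∈ markSpace E) :
    ∃ H : G ≃ₜ G, ⇑H = hφ.edgeMap p :=
  ⟨(isHomeomorph_iff_continuous_bijective.2 ⟨hφ.continuous_edgeMap.uncurry_left p,
    hφ.edgeMap_bijective hp⟩).homeomorph, rfl⟩

theorem isOpen_image_Ioo [Finite E] [T2Space G] (hφ : IsEdgeDecomposition φ) (e : E)
    (y z : unitInterval) : IsOpen (φ e '' Ioo y z) := by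
  have hcompl : (φ e '' Ioo y z)ᶜ = φ e '' (Ioo y z)ᶜ ∪ ⋃ e' ∈ {e' | e' ≠ e}, range (φ e') := by
    have hne (x : unitInterval) (hx : x ∈ Ioo y z) : x ≠ 0 ∧ x ≠ 1 :=
      ⟨(unitInterval.nonneg'.trans_lt hx.1).ne', (hx.2.trans_le unitInterval.le_one').ne⟩
    ext g
    simp only [mem_compl_iff, mem_union, mem_iUnion, mem_range, mem_ofPred_eq, exists_prop]
    constructor
    · intro hg
      obtain ⟨e', x, rfl⟩ := hφ.cover g
      by_cases he : e' = e
      · subst he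
        exact .inl ⟨x, fun hx ↦ hg ⟨x, hx, rfl⟩, rfl⟩
      · exact .inr ⟨e', he, x, rfl⟩
    · rintro (⟨x, hx, rfl⟩ | ⟨e', he, x, rfl⟩) ⟨x', hx', h⟩
      · obtain ⟨-, rfl⟩ := hφ.interior_inj _ _ _ _ (hne x' hx').1 (hne x' hx').2 h
        exact hx hx'
      · exact he (hφ.interior_inj _ _ _ _ (hne x' hx').1 (hne x' hx').2 h).1.symm
  rw [← isClosed_compl_iff, hcompl]
  refine IsClosed.union ?_ ((toFinite _).isClosed_biUnion fun e' _ ↦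
    (isCompact_range (hφ.continuous e')).isClosed)
  exact (isOpen_Ioo.isClosed_compl.isCompact.image (hφ.continuous e)).isClosed

theorem ordConnected_preimage_or [Finite E] [T2Space G] (hφ : IsEdgeDecomposition φ) {A : Set G}
    (hA : IsPreconnected A) (e : E) : (φ e ⁻¹' A).OrdConnected ∨ (φ e ⁻¹' A)ᶜ.OrdConnected := by
  have key (y u z : unitInterval) (hy : φ e y ∉ A) (hz : φ e z ∉ A) (hu : φ e u ∈ A)
      (huyz : u ∈ Ioo y z) (v : unitInterval) (hv : φ e v ∈ A) : v ∈ Ioo y z := by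
    have hsub : A ⊆ φ e '' Ioo y z := by
      refine hA.subset_left_of_subset_union (hφ.isOpen_image_Ioo e y z)
        (isCompact_Icc.image (hφ.continuous e)).isClosed.isOpen_compl
        (disjoint_compl_right.mono_right (compl_subset_compl.2 (image_mono Ioo_subset_Icc_self)))
        (fun g hg ↦ ?_) ⟨φ e u, hu, u, huyz, rfl⟩
      by_cases h : g ∈ φ e '' Icc y z
      · obtain ⟨x, hx, rfl⟩ := h
        exact .inl ⟨x, ⟨hx.1.lt_of_ne fun h ↦ hy (h ▸ hg), hx.2.lt_of_ne fun h ↦ hz (h ▸ hg)⟩, rfl⟩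
      · exact .inr h
    obtain ⟨w, hw, hwv⟩ := hsub hv
    obtain ⟨-, rfl⟩ := hφ.interior_inj _ _ _ _ (unitInterval.nonneg'.trans_lt hw.1).ne'
      (hw.2.trans_le unitInterval.le_one').ne hwv
    exact hw
  refine or_iff_not_imp_right.2 fun h ↦ ⟨fun u hu v hv w hw ↦ ?_⟩
  by_contra hwA
  refine h ⟨fun y hy z hz x hx hxA ↦ ?_⟩
  have hx' : x ∈ Ioo y z :=
    ⟨hx.1.lt_of_ne fun h ↦ hy (h ▸ hxA), hx.2.lt_of_ne fun h ↦ hz (h ▸ hxA)⟩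
  have hu' := key y x z hy hz hxA hx' u hu
  have hv' := key y x z hy hz hxA hx' v hv
  exact (key w v z hwA hz hv ⟨hw.2.lt_of_ne fun h ↦ hwA (h ▸ hv), hv'.2⟩ u hu).1.not_ge hw.1

end IsEdgeDecomposition

/-- The union of the open cells with labels in `T`, where every edge is cut at the marks
`1/3` and `2/3`. -/
def cellUnion (φ : E → unitInterval → G)
    (T : Set (E × Ordering × Ordering × Ordering × Ordering)) : Set G :=
  {g | ∃ e x, φ e x = g ∧ (e, markPosition oneThird twoThirds x) ∈ T}

theorem IsEdgeDecomposition.exists_preimage_eq_cellUnion [Finite E] [T2Space G]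
    (hφ : IsEdgeDecomposition φ) {A : Set G} (hA : IsPreconnected A) :
    ∃ p ∈ markSpace E, ∃ T, hφ.edgeMap p ⁻¹' A = cellUnion φ T := by
  have hmarks (e : E) : ∃ s t : unitInterval, 0 < s ∧ s < t ∧ t < 1 ∧
      ∀ u v, markPosition s t u = markPosition s t v → (φ e u ∈ A ↔ φ e v ∈ A) := by
    rcases hφ.ordConnected_preimage_or hA e with h | h
    · exact h.exists_marks
    · obtain ⟨s, t, h0, hst, h1, h⟩ := h.exists_marks
      exact ⟨s, t, h0, hst, h1, fun u v huv ↦ not_iff_not.1 (h u v huv)⟩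
  choose s t h0 hst h1 h using hmarks
  refine ⟨fun e ↦ (s e, t e), fun e ↦ ⟨h0 e, hst e, h1 e⟩,
    {c | ∃ x, markPosition oneThird twoThirds x = c.2 ∧ φ c.1 (bend (s c.1, t c.1) x) ∈ A}, ?_⟩
  ext g
  constructor
  · intro hg
    obtain ⟨e, x, rfl⟩ := hφ.cover g
    rw [mem_preimage, hφ.edgeMap_apply] at hg
    exact ⟨e, x, rfl, x, rfl, hg⟩
  · rintro ⟨e, x, rfl, x', hxx', hx'⟩
    rw [mem_preimage, hφ.edgeMap_apply]
    refine (h e _ _ ?_).1 hx'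
    rwa [markPosition_bend (h0 e) (hst e) (h1 e), markPosition_bend (h0 e) (hst e) (h1 e)]

end EdgeMap

/-- `NC*(G)` as a subset of the hyperspace of nonempty compact sets. -/
def ncSet (X : Type*) [MetricSpace X] : Set (NonemptyCompacts X) :=
  {A | IsConnected (A : Set X) ∧ IsPreconnected ((A : Set X)ᶜ)}

theorem map_homeomorph_mem_ncSet {X : Type*} [MetricSpace X] (H : X ≃ₜ X) {A : NonemptyCompacts X}
    (hA : A ∈ ncSet X) : A.map H H.continuous ∈ ncSet X := by
  refine ⟨?_, ?_⟩ <;> rw [NonemptyCompacts.coe_map]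
  · exact hA.1.image _ H.continuous.continuousOn
  · rw [← image_compl_eq H.bijective]
    exact hA.2.image _ H.continuous.continuousOn

theorem IsEdgeDecomposition.isPathConnected_ncSet {E G : Type*} [MetricSpace G] [CompactSpace G]
    [Finite E] {φ : E → unitInterval → G} (hφ : IsEdgeDecomposition φ)
    (hconn : IsConnected (ncSet G)) : IsPathConnected (ncSet G) := by
  have hfin : {A : NonemptyCompacts G | A ∈ ncSet G ∧ ∃ T, (A : Set G) = cellUnion φ T}.Finite :=
    ((finite_range (cellUnion φ)).preimage SetLike.coe_injective.injOn).subset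
      fun A ⟨_, T, hT⟩ ↦ ⟨T, hT.symm⟩
  have := hfin.to_subtype
  have hcont (p : E → ℝ × ℝ) : Continuous (hφ.edgeMap p) := hφ.continuous_edgeMap.uncurry_left p
  let f (A : NonemptyCompacts G) (p : E → ℝ × ℝ) : NonemptyCompacts G :=
    A.map (hφ.edgeMap p) (hcont p)
  have hf (A : NonemptyCompacts G) : Continuous (f A) :=
    continuous_const.nonemptyCompacts_map' hφ.continuous_edgeMap
  refine isPathConnected_of_finite_cells
    (fun A : {A : NonemptyCompacts G | A ∈ ncSet G ∧ ∃ T, (A : Set G) = cellUnion φ T} ↦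
      f A.1 '' markSpace E) (fun A hA ↦ ?_) (fun A x hx y hy hyS ↦ ?_) hconn
  · obtain ⟨p, hp, T, hT⟩ := hφ.exists_preimage_eq_cellUnion hA.1.isPreconnected
    obtain ⟨H, hH⟩ := hφ.exists_homeomorph_edgeMap hp
    refine mem_iUnion.2 ⟨⟨A.map H.symm H.symm.continuous, map_homeomorph_mem_ncSet H.symm hA, T, ?_⟩,
      p, hp, ?_⟩
    · rw [NonemptyCompacts.coe_map, ← hT, ← hH]
      exact H.symm.image_eq_preimage_symm _
    · refine NonemptyCompacts.ext ?_
      simp only [f, NonemptyCompacts.coe_map, ← hH, image_image, H.apply_symm_apply, image_id']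
  · refine joinedIn_of_mem_closure_image (hf A.1) isCompact_closedMarkSpace
      markSpace_subset_closedMarkSpace
      (fun q hq p hp t h0 h1 ↦ segment_mem_markSpace hq hp h0 h1) (fun q hq ↦ ?_) hx hy hyS
    obtain ⟨H, hH⟩ := hφ.exists_homeomorph_edgeMap hq
    have := map_homeomorph_mem_ncSet H A.2.1
    simpa only [f, hH] using this

/-- For a finite graph G, NC*(G) is connected iff it is path-connected. -/
theorem stmt8 {G : Type*} [MetricSpace G] [CompactSpace G] [ConnectedSpace G] [Nontrivial G]
    (hfg : IsFiniteGraph G) :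
    ConnectedSpace (NCstar G) ↔ PathConnectedSpace (NCstar G) := by
  refine ⟨fun h ↦ ?_, fun h ↦ inferInstance⟩
  obtain ⟨E, _, φ, hφ⟩ := hfg.exists_isEdgeDecomposition
  exact isPathConnected_iff_pathConnectedSpace.1
    (hφ.isPathConnected_ncSet (isConnected_iff_connectedSpace.2 h))
end
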